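/- arXiv:2211.11860 — 2 statements merged into one kernel-verified Lean document; each statement's English description precedes it below -/
import Mathlib

section
/- Let n ≥ d ≥ 3, let W ⊂ ℝ^d be any two-dimensional linear subspace, let ā₁,…,ā_n ∈ ℝ^d satisfy ‖ā_i‖₂ ≤ 1 for all i, let 0 < σ ≤ 1/(8d√(log n)), and let a₁,…,a_n be independent with a_i ∼ N(ā_i, σ²I_d). Then there is a universal constant C > 0 such that E[edges(conv(a₁,…,a_n) ∩ W)] ≤ C · σ^{−3/2} · d^{13/4} · (log n)^{5/4}. -/
open MeasureTheory Set
open scoped ENNReal ProbabilityTheory Pointwise RealInnerProductSpace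

noncomputable section

abbrev Euc (d : ℕ) := EuclideanSpace ℝ (Fin d)

/-- Number of edges (one-dimensional exposed faces) of a set. -/
def edgeCount {d : ℕ} (S : Set (Euc d)) : ℕ :=
  Set.ncard {F : Set (Euc d) | IsExposed ℝ S F ∧ Module.finrank ℝ (vectorSpan ℝ F) = 1}

/-- Density of the `d`-dimensional Gaussian with mean `m` and covariance `σ² I`. -/
def gaussPdf (d : ℕ) (m : Euc d) (σ : ℝ) (x : Euc d) : ℝ :=
  (Real.sqrt (2 * Real.pi * σ ^ 2))⁻¹ ^ d * Real.exp (-‖x - m‖ ^ 2 / (2 * σ ^ 2))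

/-- Joint law of `n` independent points in `ℝ^d`, the `i`-th having density `f i`. -/
def productDensityMeasure {n d : ℕ} (f : Fin n → Euc d → ℝ) :
    Measure (Fin n → Euc d) :=
  volume.withDensity fun ω => ENNReal.ofReal (∏ i, f i (ω i))

/-- Joint law of `n` independent Gaussian points `a_i ∼ N(m i, σ² I_d)`. -/
def jointGaussian (n d : ℕ) (m : Fin n → Euc d) (σ : ℝ) : Measure (Fin n → Euc d) :=
  productDensityMeasure fun i => gaussPdf d (m i) σ

theorem measurable_gaussPdf (d : ℕ) (m : Euc d) (σ : ℝ) : Measurable (gaussPdf d m σ) := by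
  unfold gaussPdf
  fun_prop

theorem gaussPdf_nonneg (d : ℕ) (m : Euc d) (σ : ℝ) (x : Euc d) : 0 ≤ gaussPdf d m σ x := by
  unfold gaussPdf
  positivity

theorem measurable_prod_gaussPdf {n d : ℕ} (m : Fin n → Euc d) (σ : ℝ) :
    Measurable fun ω : Fin n → Euc d => ENNReal.ofReal (∏ i, gaussPdf d (m i) σ (ω i)) := by
  refine ENNReal.measurable_ofReal.comp (Finset.measurable_prod _ fun i _ => ?_)
  exact (measurable_gaussPdf d (m i) σ).comp (measurable_pi_apply i)

/-- A Gaussian density changes by a controlled factor under a small displacement. -/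
theorem exp_mul_gaussPdf_le {d : ℕ} {m x y : Euc d} {σ ρ τ : ℝ}
    (hx : ‖x - m‖ ≤ ρ) (hy : ‖y - x‖ ≤ τ) :
    Real.exp (-((2 * ρ * τ + τ ^ 2) / (2 * σ ^ 2))) * gaussPdf d m σ x ≤ gaussPdf d m σ y := by
  have h1 : ‖y - m‖ ≤ ‖x - m‖ + τ := by
    have : y - m = (x - m) + (y - x) := by abel
    rw [this]
    exact (norm_add_le _ _).trans (by linarith)
  have h0 := norm_nonneg (x - m)
  have h0' := norm_nonneg (y - m)
  have hτ : 0 ≤ τ := (norm_nonneg _).trans hy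
  have h2 : ‖y - m‖ ^ 2 ≤ ‖x - m‖ ^ 2 + (2 * ρ * τ + τ ^ 2) := by
    nlinarith [mul_le_mul_of_nonneg_right hx hτ]
  unfold gaussPdf
  rw [mul_left_comm, ← Real.exp_add]
  refine mul_le_mul_of_nonneg_left (Real.exp_le_exp.2 ?_) (by positivity)
  rw [← neg_div, ← add_div]
  gcongr
  linarith

/-- The joint Gaussian density changes by a controlled factor if at most the points indexed by
`I` are displaced. -/
theorem exp_mul_prod_gaussPdf_le {n d : ℕ} {m ω ω' : Fin n → Euc d} {σ ρ τ : ℝ}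
    (I : Finset (Fin n)) (hI : ∀ i ∉ I, ω' i = ω i)
    (hx : ∀ i, ‖ω i - m i‖ ≤ ρ) (hy : ∀ i, ‖ω' i - ω i‖ ≤ τ) :
    Real.exp (-(I.card * ((2 * ρ * τ + τ ^ 2) / (2 * σ ^ 2)))) *
      ∏ i, gaussPdf d (m i) σ (ω i) ≤ ∏ i, gaussPdf d (m i) σ (ω' i) := by
  classical
  have hcard : Real.exp (-(I.card * ((2 * ρ * τ + τ ^ 2) / (2 * σ ^ 2)))) =
      ∏ i : Fin n, if i ∈ I then Real.exp (-((2 * ρ * τ + τ ^ 2) / (2 * σ ^ 2))) else 1 := by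
    rw [Finset.prod_ite_mem, Finset.univ_inter, Finset.prod_const, ← Real.exp_nat_mul]
    ring_nf
  rw [hcard, ← Finset.prod_mul_distrib]
  refine Finset.prod_le_prod (fun i _ => ?_) (fun i _ => ?_)
  · split_ifs
    · exact mul_nonneg (Real.exp_nonneg _) (gaussPdf_nonneg ..)
    · simpa using gaussPdf_nonneg ..
  · split_ifs with h
    · exact exp_mul_gaussPdf_le (hx i) (hy i)
    · rw [hI i h, one_mul]

/-- A map that does not increase volume and changes the joint density by a factor at least `r`
on `A` sends `A` to sets of comparable Gaussian measure. -/
theorem ofReal_mul_jointGaussian_le {n d : ℕ} {m : Fin n → Euc d} {σ r : ℝ} (hr : 0 ≤ r)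
    {T : (Fin n → Euc d) → Fin n → Euc d} (hT : Measurable T)
    (hvol : Measure.map T volume ≤ volume) {A B : Set (Fin n → Euc d)}
    (hA : MeasurableSet A) (hB : MeasurableSet B) (hAB : ∀ ω ∈ A, T ω ∈ B)
    (hdens : ∀ ω ∈ A, r * ∏ i, gaussPdf d (m i) σ (ω i) ≤ ∏ i, gaussPdf d (m i) σ (T ω i)) :
    ENNReal.ofReal r * jointGaussian n d m σ A ≤ jointGaussian n d m σ B := by
  have hg := measurable_prod_gaussPdf m σ
  rw [jointGaussian, productDensityMeasure, withDensity_apply _ hA, withDensity_apply _ hB,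
    ← lintegral_const_mul _ hg, ← lintegral_indicator hA, ← lintegral_indicator hB]
  refine le_trans ?_ (lintegral_mono' hvol le_rfl)
  rw [lintegral_map (hg.indicator hB) hT]
  refine lintegral_mono fun ω => ?_
  by_cases hω : ω ∈ A
  · rw [indicator_of_mem hω, indicator_of_mem (hAB ω hω), ← ENNReal.ofReal_mul hr]
    exact ENNReal.ofReal_le_ofReal (hdens ω hω)
  · rw [indicator_of_notMem hω]
    exact bot_le

theorem integral_gaussPdf {d : ℕ} (m : Euc d) {σ : ℝ} (hσ : 0 < σ) :
    ∫ x, gaussPdf d m σ x = 1 := by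
  have hb : 0 < 1 / (2 * σ ^ 2) := by positivity
  have h1 : ∫ x : Euc d, Real.exp (-‖x - m‖ ^ 2 / (2 * σ ^ 2)) =
      (2 * Real.pi * σ ^ 2) ^ ((d : ℝ) / 2) := by
    rw [integral_sub_right_eq_self (fun x : Euc d => Real.exp (-‖x‖ ^ 2 / (2 * σ ^ 2))) m]
    have := GaussianFourier.integral_rexp_neg_mul_sq_norm (V := Euc d) hb
    simp only [finrank_euclideanSpace, Fintype.card_fin] at this
    rw [show 2 * Real.pi * σ ^ 2 = Real.pi / (1 / (2 * σ ^ 2)) by field_simp, ← this]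
    refine integral_congr_ae (Filter.Eventually.of_forall fun x => ?_)
    simp only
    congr 1
    ring
  unfold gaussPdf
  rw [integral_const_mul, h1, Real.sqrt_eq_rpow, ← Real.rpow_neg (by positivity),
    ← Real.rpow_mul_natCast (by positivity), ← Real.rpow_add (by positivity)]
  ring_nf
  exact Real.rpow_zero _

theorem integrable_gaussPdf {d : ℕ} (m : Euc d) {σ : ℝ} (hσ : 0 < σ) :
    Integrable (gaussPdf d m σ) := by
  by_contra h
  have := integral_gaussPdf m hσ
  rw [integral_undef h] at this
  exact zero_ne_one this

theorem gaussPdf_le_of_lt_norm {d : ℕ} {m x : Euc d} {σ ρ : ℝ} (hσ : 0 < σ) (hρ : 0 ≤ ρ)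
    (hx : ρ < ‖x - m‖) :
    gaussPdf d m σ x ≤
      Real.exp (-ρ ^ 2 / (4 * σ ^ 2)) * Real.sqrt 2 ^ d * gaussPdf d m (Real.sqrt 2 * σ) x := by
  unfold gaussPdf
  have h2 : Real.sqrt 2 ^ 2 = 2 := Real.sq_sqrt (by norm_num)
  have h3 : Real.sqrt (2 * Real.pi * (Real.sqrt 2 * σ) ^ 2) =
      Real.sqrt 2 * Real.sqrt (2 * Real.pi * σ ^ 2) := by
    rw [← Real.sqrt_mul (by norm_num), mul_pow, h2]
    ring_nf
  rw [h3, mul_inv, mul_pow (Real.sqrt 2)⁻¹]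
  have h4 : Real.sqrt 2 ^ d * (Real.sqrt 2)⁻¹ ^ d = 1 := by
    rw [← mul_pow, mul_inv_cancel₀ (by positivity), one_pow]
  have h5 : Real.exp (-ρ ^ 2 / (4 * σ ^ 2)) * Real.sqrt 2 ^ d *
      ((Real.sqrt 2)⁻¹ ^ d * (Real.sqrt (2 * Real.pi * σ ^ 2))⁻¹ ^ d *
        Real.exp (-‖x - m‖ ^ 2 / (2 * (Real.sqrt 2 * σ) ^ 2))) =
      (Real.sqrt (2 * Real.pi * σ ^ 2))⁻¹ ^ d * (Real.exp (-ρ ^ 2 / (4 * σ ^ 2)) *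
        Real.exp (-‖x - m‖ ^ 2 / (2 * (Real.sqrt 2 * σ) ^ 2))) := by
    linear_combination (Real.sqrt (2 * Real.pi * σ ^ 2))⁻¹ ^ d *
      (Real.exp (-ρ ^ 2 / (4 * σ ^ 2)) *
        Real.exp (-‖x - m‖ ^ 2 / (2 * (Real.sqrt 2 * σ) ^ 2))) * h4
  rw [h5, ← Real.exp_add, mul_pow, h2]
  refine mul_le_mul_of_nonneg_left (Real.exp_le_exp.2 ?_) (by positivity)
  have h6 : -‖x - m‖ ^ 2 / (2 * σ ^ 2) =
      -‖x - m‖ ^ 2 / (4 * σ ^ 2) + -‖x - m‖ ^ 2 / (2 * (2 * σ ^ 2)) := by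
    field_simp
    ring
  rw [h6]
  gcongr

theorem lintegral_ofReal_prod {n d : ℕ} (f : Fin n → Euc d → ℝ) (hf : ∀ i, Integrable (f i))
    (h0 : ∀ i x, 0 ≤ f i x) :
    ∫⁻ ω : Fin n → Euc d, ENNReal.ofReal (∏ i, f i (ω i)) =
      ENNReal.ofReal (∏ i, ∫ x, f i x) := by
  have h : Integrable (fun ω : Fin n → Euc d => ∏ i, f i (ω i)) volume :=
    Integrable.fintype_prod hf
  rw [← ofReal_integral_eq_lintegral_ofReal h
    (Filter.Eventually.of_forall fun ω => Finset.prod_nonneg fun i _ => h0 i (ω i))]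
  congr 1
  exact integral_fintype_prod_volume_eq_prod f

instance isProbabilityMeasure_jointGaussian {n d : ℕ} (m : Fin n → Euc d) (σ : ℝ)
    [hσ : Fact (0 < σ)] : IsProbabilityMeasure (jointGaussian n d m σ) := by
  constructor
  rw [jointGaussian, productDensityMeasure, withDensity_apply _ MeasurableSet.univ,
    setLIntegral_univ, lintegral_ofReal_prod _ (fun i => integrable_gaussPdf (m i) hσ.out)
      (fun i => gaussPdf_nonneg d (m i) σ)]
  simp [integral_gaussPdf _ hσ.out]

/-- Tail bound for one of the Gaussian points. -/
theorem jointGaussian_lt_norm_le {n d : ℕ} (m : Fin n → Euc d) {σ ρ : ℝ} (hσ : 0 < σ)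
    (hρ : 0 ≤ ρ) (j : Fin n) :
    jointGaussian n d m σ {ω | ρ < ‖ω j - m j‖} ≤
      ENNReal.ofReal (Real.exp (-ρ ^ 2 / (4 * σ ^ 2)) * Real.sqrt 2 ^ d) := by
  classical
  have hs : MeasurableSet {ω : Fin n → Euc d | ρ < ‖ω j - m j‖} :=
    measurableSet_lt measurable_const (by fun_prop)
  have hs' : MeasurableSet {x : Euc d | ρ < ‖x - m j‖} :=
    measurableSet_lt measurable_const (by fun_prop)
  let f : Fin n → Euc d → ℝ := Function.update (fun i => gaussPdf d (m i) σ) j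
    ({x : Euc d | ρ < ‖x - m j‖}.indicator (gaussPdf d (m j) σ))
  have hf : ∀ i, Integrable (f i) := by
    intro i
    by_cases h : i = j
    · subst h
      simpa [f] using (integrable_gaussPdf (m i) hσ).indicator hs'
    · simpa [f, h] using integrable_gaussPdf (m i) hσ
  have h0 : ∀ i x, 0 ≤ f i x := by
    intro i x
    by_cases h : i = j
    · subst h
      simpa [f] using indicator_nonneg (fun x _ => gaussPdf_nonneg d (m i) σ x) x
    · simpa [f, h] using gaussPdf_nonneg d (m i) σ x
  have h1 : jointGaussian n d m σ {ω | ρ < ‖ω j - m j‖} =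
      ∫⁻ ω : Fin n → Euc d, ENNReal.ofReal (∏ i, f i (ω i)) := by
    rw [jointGaussian, productDensityMeasure, withDensity_apply _ hs, ← lintegral_indicator hs]
    refine lintegral_congr fun ω => ?_
    by_cases hω : ρ < ‖ω j - m j‖
    · rw [indicator_of_mem (s := {ω : Fin n → Euc d | ρ < ‖ω j - m j‖}) hω]
      congr 1
      refine Finset.prod_congr rfl fun i _ => ?_
      by_cases h : i = j
      · subst h
        simp [f, hω]
      · simp [f, h]
    · rw [indicator_of_notMem (s := {ω : Fin n → Euc d | ρ < ‖ω j - m j‖}) hω,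
        Finset.prod_eq_zero (Finset.mem_univ j) (by simp [f, hω])]
      simp
  rw [h1, lintegral_ofReal_prod f hf h0]
  refine ENNReal.ofReal_le_ofReal ?_
  rw [← Finset.mul_prod_erase _ _ (Finset.mem_univ j),
    Finset.prod_eq_one (s := Finset.univ.erase j), mul_one]
  · have hσ' : 0 < Real.sqrt 2 * σ := by positivity
    calc ∫ x, f j x ≤ ∫ x, Real.exp (-ρ ^ 2 / (4 * σ ^ 2)) * Real.sqrt 2 ^ d *
          gaussPdf d (m j) (Real.sqrt 2 * σ) x := by
          refine integral_mono (hf j) ((integrable_gaussPdf (m j) hσ').const_mul _) fun x => ?_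
          by_cases hx : ρ < ‖x - m j‖
          · simpa [f, hx] using gaussPdf_le_of_lt_norm hσ hρ hx
          · have := gaussPdf_nonneg d (m j) (Real.sqrt 2 * σ) x
            simp only [f, Function.update_self, indicator_of_notMem (s := {x | ρ < ‖x - m j‖}) hx]
            positivity
      _ = _ := by rw [integral_const_mul, integral_gaussPdf _ hσ', mul_one]
  · intro i hi
    simp [f, (Finset.mem_erase.1 hi).1, integral_gaussPdf _ hσ]

theorem map_homothety_volume_le {d : ℕ} (a : Euc d) {c : ℝ} (hc : 1 ≤ c) :
    Measure.map (fun y : Euc d => a + c • (y - a)) volume ≤ volume := by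
  have h1 : (fun y : Euc d => a + c • (y - a)) =
      (fun y => (a - c • a) + y) ∘ (fun y => c • y) := by
    ext1 y
    simp only [Function.comp, smul_sub]
    abel
  rw [h1, ← Measure.map_map (by fun_prop) (by fun_prop),
    Measure.map_addHaar_smul _ (by positivity), Measure.map_smul, map_add_left_eq_self]
  intro s
  simp only [Measure.smul_apply, smul_eq_mul]
  refine mul_le_of_le_one_left bot_le ?_
  rw [ENNReal.ofReal_le_one, abs_inv, abs_of_nonneg (by positivity)]
  exact inv_le_one_of_one_le₀ (one_le_pow₀ hc)

theorem map_update_volume_le {n d : ℕ} (i : Fin n) (φ : (Fin n → Euc d) → Euc d → Euc d)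
    (hφ : Measurable fun x : Fin n → Euc d => φ x (x i))
    (hi : ∀ x y, φ (Function.update x i y) = φ x)
    (hφ' : ∀ x, Measurable (φ x))
    (hvol : ∀ x, Measure.map (φ x) volume ≤ volume) :
    Measure.map (fun x : Fin n → Euc d => Function.update x i (φ x (x i))) volume ≤ volume := by
  have hT : Measurable fun x : Fin n → Euc d => Function.update x i (φ x (x i)) := by
    refine measurable_pi_iff.2 fun j => ?_
    by_cases h : j = i
    · subst h
      simpa using hφ
    · simpa [h] using measurable_pi_apply j
  refine Measure.le_iff.2 fun s hs => ?_
  have h1 : Measurable (s.indicator (1 : (Fin n → Euc d) → ℝ≥0∞)) := measurable_one.indicator hs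
  rw [← lintegral_indicator_one hs, ← lintegral_indicator_one hs, lintegral_map h1 hT]
  refine lintegral_le_of_lmarginal_le (μ := fun _ => volume) {i} (h1.comp hT) h1 fun x => ?_
  rw [lmarginal_singleton, lmarginal_singleton]
  simp only [hi, Function.update_self, Function.update_idem]
  refine le_trans (le_of_eq ?_) (lintegral_mono' (hvol x) le_rfl)
  exact (lintegral_map (h1.comp (measurable_update x)) (hφ' x)).symm

/-- Dilating some of the points away from another one. -/
def dilateAt {n d : ℕ} (q : Fin n) (c : ℝ) (K : Finset (Fin n)) (ω : Fin n → Euc d) :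
    Fin n → Euc d :=
  fun i => if i ∈ K then ω q + c • (ω i - ω q) else ω i

theorem measurable_dilateAt {n d : ℕ} (q : Fin n) (c : ℝ) (K : Finset (Fin n)) :
    Measurable (dilateAt (d := d) q c K) := by
  refine measurable_pi_iff.2 fun i => ?_
  unfold dilateAt
  split_ifs <;> fun_prop

theorem map_dilateAt_volume_le {n d : ℕ} {q : Fin n} {c : ℝ} (hc : 1 ≤ c)
    (K : Finset (Fin n)) (hq : q ∉ K) :
    Measure.map (dilateAt (d := d) q c K) volume ≤ volume := by
  classical
  induction K using Finset.induction_on with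
  | empty =>
    have h : dilateAt (d := d) q c ∅ = id := by
      ext1 x
      funext i
      simp [dilateAt]
    rw [h, Measure.map_id]
  | insert i K hi ih =>
    have hqi : q ≠ i := fun h => hq (h ▸ Finset.mem_insert_self _ _)
    have hqK : q ∉ K := fun h => hq (Finset.mem_insert_of_mem h)
    have h1 : dilateAt (d := d) q c (insert i K) =
        (fun x => Function.update x i (x q + c • (x i - x q))) ∘ dilateAt q c K := by
      ext1 x
      funext j
      by_cases h : j = i
      · subst h
        simp [dilateAt, hi, hqK]
      · simp [dilateAt, h]
    have hm : Measurable fun x : Fin n → Euc d =>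
        Function.update x i (x q + c • (x i - x q)) := by
      refine measurable_pi_iff.2 fun j => ?_
      by_cases h : j = i
      · subst h
        simp only [Function.update_self]
        fun_prop
      · simpa [h] using measurable_pi_apply j
    rw [h1, ← Measure.map_map hm (measurable_dilateAt q c K)]
    refine (Measure.map_mono (ih hqK) hm).trans ?_
    exact map_update_volume_le i (fun x y => x q + c • (y - x q)) (by fun_prop)
      (fun x y => by simp [hqi]) (fun x => by fun_prop)
      (fun x => map_homothety_volume_le (x q) hc)

theorem volume_setOf_one_prod_mem_eq_zero {d : ℕ} {M : Type*} [NormedAddCommGroup M]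
    [NormedSpace ℝ M] [FiniteDimensional ℝ M] (π : Euc d →L[ℝ] M) (hπ : Function.Surjective π)
    (V : Submodule ℝ (ℝ × M)) (hV : V ≠ ⊤) :
    volume {y : Euc d | ((1 : ℝ), π y) ∈ V} = 0 := by
  let g : Euc d →ᵃ[ℝ] ℝ × M := (AffineMap.const ℝ (Euc d) (1 : ℝ)).prod π.toLinearMap.toAffineMap
  have h1 : {y : Euc d | ((1 : ℝ), π y) ∈ V} = (V.toAffineSubspace.comap g : Set (Euc d)) := by
    ext y
    simp [g]
  rw [h1]
  refine Measure.addHaar_affineSubspace _ _ fun htop => hV ?_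
  have h2 : ∀ y, ((1 : ℝ), π y) ∈ V := fun y => by
    have : y ∈ (V.toAffineSubspace.comap g : Set (Euc d)) := by rw [htop]; trivial
    rw [← h1] at this
    exact this
  refine eq_top_iff.2 fun z _ => ?_
  obtain ⟨y, hy⟩ := hπ z.2
  have h3 : z = ((1 : ℝ), π y) + (z.1 - 1) • ((1 : ℝ), π 0) := by
    ext <;> simp [hy]
  rw [h3]
  exact V.add_mem (h2 y) (V.smul_mem _ (h2 0))

theorem isOpen_setOf_linearIndepOn {n d : ℕ} {M : Type*} [NormedAddCommGroup M]
    [NormedSpace ℝ M] [FiniteDimensional ℝ M] (π : Euc d →L[ℝ] M) (S : Finset (Fin n)) :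
    IsOpen {ω : Fin n → Euc d | LinearIndepOn ℝ (fun i => ((1 : ℝ), π (ω i))) (S : Set (Fin n))} := by
  have h : Continuous fun (ω : Fin n → Euc d) (i : (S : Set (Fin n))) => ((1 : ℝ), π (ω i)) := by
    fun_prop
  exact isOpen_setOfPred_linearIndependent.preimage h

/-- Points in general position: almost surely few projected points are affinely independent. -/
theorem ae_linearIndepOn {n d : ℕ} {M : Type*} [NormedAddCommGroup M]
    [NormedSpace ℝ M] [FiniteDimensional ℝ M] (π : Euc d →L[ℝ] M) (hπ : Function.Surjective π)
    (S : Finset (Fin n)) (hS : S.card ≤ Module.finrank ℝ M + 1) :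
    ∀ᵐ ω : Fin n → Euc d, LinearIndepOn ℝ (fun i => ((1 : ℝ), π (ω i))) (S : Set (Fin n)) := by
  classical
  induction S using Finset.induction_on with
  | empty => simp
  | insert a S ha ih =>
    rw [Finset.card_insert_of_notMem ha] at hS
    have ih' := ih (by omega)
    set G : Finset (Fin n) → Set (Fin n → Euc d) := fun S =>
      {ω | LinearIndepOn ℝ (fun i => ((1 : ℝ), π (ω i))) (S : Set (Fin n))}
    have hG : ∀ S, MeasurableSet (G S) := fun S => (isOpen_setOf_linearIndepOn π S).measurableSet
    have hB : MeasurableSet (G S \ G (insert a S)) := (hG S).diff (hG _)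
    have h0 : volume (G S \ G (insert a S)) = 0 := by
      rw [← lintegral_indicator_one hB, ← lintegral_zero (μ := (volume : Measure (Fin n → Euc d)))]
      refine lintegral_eq_of_lmarginal_eq (μ := fun _ => volume) {a} (measurable_one.indicator hB)
        measurable_const ?_
      ext1 x
      rw [lmarginal_singleton, lmarginal_singleton, lintegral_zero]
      by_cases hx : x ∈ G S
      · have hne : Submodule.span ℝ ((fun i => ((1 : ℝ), π (x i))) '' (S : Set (Fin n))) ≠ ⊤ := by
          intro h
          have h2 := finrank_span_le_card (R := ℝ)
            ((fun i => ((1 : ℝ), π (x i))) '' (S : Set (Fin n)))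
          rw [h, finrank_top, Module.finrank_prod, Module.finrank_self, Set.toFinset_card] at h2
          have h3 : Fintype.card ((fun i => ((1 : ℝ), π (x i))) '' (S : Set (Fin n))) ≤ S.card := by
            rw [← Set.toFinset_card]
            simpa [Set.toFinset_image] using Finset.card_image_le (s := S)
              (f := fun i => ((1 : ℝ), π (x i)))
          omega
        have h4 := volume_setOf_one_prod_mem_eq_zero π hπ _ hne
        refine (lintegral_congr_ae ?_).trans lintegral_zero
        filter_upwards [measure_eq_zero_iff_ae_notMem.1 h4] with y hy
        refine indicator_of_notMem (fun hmem => hmem.2 ?_) _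
        simp only [G, Finset.coe_insert, mem_ofPred_eq]
        rw [linearIndepOn_insert (by simpa using ha)]
        have him : (fun i => ((1 : ℝ), π (Function.update x a y i))) '' (S : Set (Fin n)) =
            (fun i => ((1 : ℝ), π (x i))) '' (S : Set (Fin n)) := by
          refine image_congr fun i hi => ?_
          rw [Function.update_of_ne (fun h => ha (by simpa [h] using hi))]
        rw [him]
        refine ⟨hmem.1, by simpa using hy⟩
      · refine (lintegral_congr fun y => ?_).trans lintegral_zero
        refine indicator_of_notMem (fun hmem => hx ?_) _
        have h5 : LinearIndepOn ℝ (fun i => ((1 : ℝ), π (Function.update x a y i)))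
            (S : Set (Fin n)) := hmem.1
        refine mem_ofPred_eq.mpr (h5.congr fun i hi => ?_)
        simp only
        rw [Function.update_of_ne (fun h => ha (by simpa [h] using hi))]
    filter_upwards [ih', measure_eq_zero_iff_ae_notMem.1 h0] with ω h1 h2
    by_contra h3
    exact h2 ⟨h1, h3⟩

/-- `b` are the barycentric coordinates of a point of `W` in the convex hull of the points
indexed by `I`. -/
def IsSectionPoint {n d : ℕ} (W : Submodule ℝ (Euc d)) (I : Finset (Fin n)) (ω : Fin n → Euc d)
    (b : Fin n → ℝ) : Prop :=
  b ∈ stdSimplex ℝ (Fin n) ∧ (∀ i ∉ I, b i = 0) ∧ ∑ i, b i • ω i ∈ W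

/-- The hyperplane `⟪f, ·⟫ = β` contains the points indexed by `I` and leaves the others at
distance `δ` below; `f` is normalised along `w` and `w'`. -/
def IsSupport {n d : ℕ} (w w' : Euc d) (I : Finset (Fin n)) (δ : ℝ) (ω : Fin n → Euc d)
    (f : Euc d) (β : ℝ) : Prop :=
  ⟪f, w⟫ = 1 ∧ |⟪f, w'⟫| ≤ 1 ∧ (∀ i ∈ I, ⟪f, ω i⟫ = β) ∧ ∀ j ∉ I, ⟪f, ω j⟫ ≤ β - δ

/-- The points indexed by `I` span a facet meeting `W`, with gap at least `δ`. -/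
def gapSet {n d : ℕ} (W : Submodule ℝ (Euc d)) (w w' : Euc d) (I : Finset (Fin n)) (δ : ℝ) :
    Set (Fin n → Euc d) :=
  {ω | (∃ f β, IsSupport w w' I δ ω f β) ∧ ∃ b, IsSectionPoint W I ω b}

/-- The section points with vanishing `p`-th coordinate and `q`-th coordinate in `[s, t]`. -/
def coordSet {n d : ℕ} (W : Submodule ℝ (Euc d)) (I : Finset (Fin n)) (p q : Fin n) (s t : ℝ) :
    Set (Fin n → Euc d) :=
  {ω | ∃ b, IsSectionPoint W I ω b ∧ b p = 0 ∧ s ≤ b q ∧ b q ≤ t}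

/-- All points are within `ρ` of their means. -/
def nearSet {n d : ℕ} (m : Fin n → Euc d) (ρ : ℝ) : Set (Fin n → Euc d) :=
  {ω | ∀ i, ‖ω i - m i‖ ≤ ρ}

theorem measurableSet_nearSet {n d : ℕ} (m : Fin n → Euc d) (ρ : ℝ) :
    MeasurableSet (nearSet m ρ) := by
  have : nearSet m ρ = ⋂ i, {ω | ‖ω i - m i‖ ≤ ρ} := by
    ext ω
    simp [nearSet]
  rw [this]
  exact MeasurableSet.iInter fun i => measurableSet_le (by fun_prop) measurable_const

theorem isClosed_setOf_exists_mem_of_isCompact {X Y : Type*} [TopologicalSpace X]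
    [TopologicalSpace Y] {K : Set X} (hK : IsCompact K) {C : Set (X × Y)} (hC : IsClosed C) :
    IsClosed {y | ∃ x ∈ K, (x, y) ∈ C} := by
  have : CompactSpace K := isCompact_iff_compactSpace.1 hK
  have h1 : {y | ∃ x ∈ K, (x, y) ∈ C} =
      Prod.snd '' ((fun z : K × Y => ((z.1 : X), z.2)) ⁻¹' C) := by
    ext y
    simp
  rw [h1]
  exact isClosedMap_snd_of_compactSpace _ (hC.preimage (by fun_prop))

theorem isClosed_setOf_isSectionPoint {n d : ℕ} (W : Submodule ℝ (Euc d)) (I : Finset (Fin n)) :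
    IsClosed {z : (Fin n → ℝ) × (Fin n → Euc d) | IsSectionPoint W I z.2 z.1} := by
  have h1 : {z : (Fin n → ℝ) × (Fin n → Euc d) | IsSectionPoint W I z.2 z.1} =
      Prod.fst ⁻¹' (stdSimplex ℝ (Fin n)) ∩
        ((⋂ i : Fin n, ⋂ _ : i ∉ I, {z : (Fin n → ℝ) × (Fin n → Euc d) | z.1 i = 0}) ∩
        (fun z : (Fin n → ℝ) × (Fin n → Euc d) => ∑ i, z.1 i • z.2 i) ⁻¹' (W : Set (Euc d))) := by
    ext z
    simp [IsSectionPoint]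
  rw [h1]
  refine ((isClosed_stdSimplex ℝ (Fin n)).preimage continuous_fst).inter (IsClosed.inter ?_ ?_)
  · exact isClosed_iInter fun i => isClosed_iInter fun _ =>
      isClosed_eq (by fun_prop) continuous_const
  · exact W.closed_of_finiteDimensional.preimage (by fun_prop)

theorem isClosed_coordSet {n d : ℕ} (W : Submodule ℝ (Euc d)) (I : Finset (Fin n)) (p q : Fin n)
    (s t : ℝ) : IsClosed (coordSet W I p q s t) := by
  have h1 : coordSet W I p q s t = {ω | ∃ b ∈ stdSimplex ℝ (Fin n), (b, ω) ∈
      {z : (Fin n → ℝ) × (Fin n → Euc d) | IsSectionPoint W I z.2 z.1} ∩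
      ({z | z.1 p = 0} ∩ ({z | s ≤ z.1 q} ∩ {z | z.1 q ≤ t}))} := by
    ext ω
    simp only [coordSet, mem_ofPred_eq, mem_inter_iff]
    exact ⟨fun ⟨b, h⟩ => ⟨b, h.1.1, h⟩, fun ⟨b, _, h⟩ => ⟨b, h⟩⟩
  rw [h1]
  refine isClosed_setOf_exists_mem_of_isCompact (isCompact_stdSimplex ℝ (Fin n)) ?_
  refine (isClosed_setOf_isSectionPoint W I).inter ?_
  exact (isClosed_eq (by fun_prop) continuous_const).inter
    ((isClosed_le continuous_const (by fun_prop)).inter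
      (isClosed_le (by fun_prop) continuous_const))

theorem isClosed_setOf_isSupport {n d : ℕ} (w w' : Euc d) (I : Finset (Fin n)) (δ : ℝ) :
    IsClosed {z : (Euc d × ℝ) × (Fin n → Euc d) | IsSupport w w' I δ z.2 z.1.1 z.1.2} := by
  have h1 : {z : (Euc d × ℝ) × (Fin n → Euc d) | IsSupport w w' I δ z.2 z.1.1 z.1.2} =
      {z | ⟪z.1.1, w⟫ = 1} ∩ ({z | |⟪z.1.1, w'⟫| ≤ 1} ∩
        ((⋂ i : Fin n, ⋂ _ : i ∈ I, {z | ⟪z.1.1, z.2 i⟫ = z.1.2}) ∩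
        (⋂ i : Fin n, ⋂ _ : i ∉ I, {z | ⟪z.1.1, z.2 i⟫ ≤ z.1.2 - δ}))) := by
    ext z
    simp [IsSupport]
  rw [h1]
  refine (isClosed_eq (by fun_prop) continuous_const).inter
    ((isClosed_le (by fun_prop) continuous_const).inter (IsClosed.inter ?_ ?_))
  · exact isClosed_iInter fun i => isClosed_iInter fun _ => isClosed_eq (by fun_prop) (by fun_prop)
  · exact isClosed_iInter fun i => isClosed_iInter fun _ => isClosed_le (by fun_prop) (by fun_prop)

theorem measurableSet_gapSet {n d : ℕ} (W : Submodule ℝ (Euc d)) (w w' : Euc d)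
    (I : Finset (Fin n)) (δ : ℝ) : MeasurableSet (gapSet W w w' I δ) := by
  have h1 : gapSet W w w' I δ =
      (⋃ k : ℕ, {ω | ∃ z ∈ Metric.closedBall (0 : Euc d × ℝ) k, (z, ω) ∈
        {z : (Euc d × ℝ) × (Fin n → Euc d) | IsSupport w w' I δ z.2 z.1.1 z.1.2}}) ∩
      {ω | ∃ b ∈ stdSimplex ℝ (Fin n), (b, ω) ∈
        {z : (Fin n → ℝ) × (Fin n → Euc d) | IsSectionPoint W I z.2 z.1}} := by
    ext ω
    simp only [gapSet, mem_ofPred_eq, mem_inter_iff, mem_iUnion]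
    refine and_congr ⟨?_, ?_⟩ ⟨fun ⟨b, h⟩ => ⟨b, h.1, h⟩, fun ⟨b, _, h⟩ => ⟨b, h⟩⟩
    · rintro ⟨f, β, h⟩
      obtain ⟨k, hk⟩ := exists_nat_ge ‖(f, β)‖
      exact ⟨k, (f, β), by simpa using hk, h⟩
    · rintro ⟨k, z, _, h⟩
      exact ⟨z.1, z.2, h⟩
  rw [h1]
  refine MeasurableSet.inter (MeasurableSet.iUnion fun k => ?_) ?_
  · exact (isClosed_setOf_exists_mem_of_isCompact (isCompact_closedBall _ _)
      (isClosed_setOf_isSupport w w' I δ)).measurableSet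
  · exact (isClosed_setOf_exists_mem_of_isCompact (isCompact_stdSimplex ℝ (Fin n))
      (isClosed_setOf_isSectionPoint W I)).measurableSet

theorem gapSet_anti {n d : ℕ} (W : Submodule ℝ (Euc d)) (w w' : Euc d)
    (I : Finset (Fin n)) {δ : ℝ} (hδ : 0 ≤ δ) : gapSet W w w' I δ ⊆ gapSet W w w' I 0 := by
  rintro ω ⟨⟨f, β, h1, h2, h3, h4⟩, hb⟩
  exact ⟨⟨f, β, h1, h2, h3, fun j hj => (h4 j hj).trans (by linarith)⟩, hb⟩

/-- Pushing the facet outwards creates a gap at little cost. -/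
theorem exp_mul_jointGaussian_gapSet_le {n d : ℕ} {m : Fin n → Euc d} {σ ρ δ : ℝ}
    (hδ : 0 ≤ δ) {W : Submodule ℝ (Euc d)} {w w' : Euc d} (hw : w ∈ W)
    (hw1 : ‖w‖ = 1) (I : Finset (Fin n)) :
    ENNReal.ofReal (Real.exp (-(I.card * ((2 * ρ * δ + δ ^ 2) / (2 * σ ^ 2))))) *
      jointGaussian n d m σ (gapSet W w w' I 0 ∩ nearSet m ρ) ≤
      jointGaussian n d m σ (gapSet W w w' I δ) := by
  classical
  let v : Fin n → Euc d := fun i => if i ∈ I then δ • w else 0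
  refine ofReal_mul_jointGaussian_le (Real.exp_nonneg _) (T := fun ω => ω + v)
    (measurable_add_const v) (map_add_right_eq_self _ _).le
    ((measurableSet_gapSet W w w' I 0).inter (measurableSet_nearSet m ρ))
    (measurableSet_gapSet W w w' I δ) ?_ ?_
  · rintro ω ⟨⟨⟨f, β, h1, h2, h3, h4⟩, b, hb, hbI, hbW⟩, -⟩
    refine ⟨⟨f, β + δ, h1, h2, fun i hi => ?_, fun j hj => ?_⟩, b, hb, hbI, ?_⟩
    · simp [v, hi, inner_add_right, inner_smul_right, h1, h3 i hi]
    · simpa [v, hj] using h4 j hj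
    · simp only [Pi.add_apply, smul_add, Finset.sum_add_distrib]
      refine W.add_mem hbW (W.sum_mem fun i _ => W.smul_mem _ ?_)
      simp only [v]
      split_ifs
      · exact W.smul_mem _ hw
      · exact W.zero_mem
  · rintro ω ⟨-, hω⟩
    refine exp_mul_prod_gaussPdf_le I (fun i hi => by simp [v, hi]) hω fun i => ?_
    simp only [Pi.add_apply, add_sub_cancel_left, v]
    split_ifs
    · rw [norm_smul, hw1, Real.norm_of_nonneg hδ, mul_one]
    · simpa using hδ

theorem dilateAt_mem {n d : ℕ} {W : Submodule ℝ (Euc d)} {w w' : Euc d} {I : Finset (Fin n)}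
    {p q : Fin n} (hp : p ∈ I) (hq : q ∈ I) (hpq : p ≠ q) {η θ : ℝ}
    (hθ0 : 0 ≤ θ) (hθ1 : θ < 1) {ω : Fin n → Euc d}
    (hω : ω ∈ gapSet W w w' I 0 ∩ coordSet W I p q 0 η) :
    dilateAt q (1 / (1 - θ)) ((I.erase p).erase q) ω ∈
      gapSet W w w' I 0 ∩ coordSet W I p q θ (θ + η) := by
  classical
  obtain ⟨⟨⟨f, β, h1, h2, h3, h4⟩, -⟩, b, ⟨⟨hb0, hb1⟩, hbI, hbW⟩, hbp, hbq0, hbq⟩ := hω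
  set K := (I.erase p).erase q
  have hθ : 0 < 1 - θ := by linarith
  let b' : Fin n → ℝ := fun i => (1 - θ) * b i + if i = q then θ else 0
  have hb'p : b' p = 0 := by simp [b', hbp, hpq]
  have hb'I : ∀ i ∉ I, b' i = 0 := by
    intro i hi
    have : i ≠ q := fun h => hi (h ▸ hq)
    simp [b', hbI i hi, this]
  have hb's : b' ∈ stdSimplex ℝ (Fin n) := by
    refine ⟨fun i => ?_, ?_⟩
    · have := hb0 i
      simp only [b']
      split_ifs <;> positivity
    · simp [b', Finset.sum_add_distrib, ← Finset.mul_sum, hb1]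
  have hsum : ∑ i, b' i • dilateAt q (1 / (1 - θ)) K ω i = ∑ i, b i • ω i := by
    have h5 : ∀ i, b' i • dilateAt q (1 / (1 - θ)) K ω i =
        b i • ω i - b i • ω q + b' i • ω q := by
      intro i
      by_cases hiq : i = q
      · subst hiq
        simp [dilateAt, K]
      by_cases hip : i = p
      · subst hip
        simp [hb'p, hbp]
      by_cases hiI : i ∈ I
      · have hiK : i ∈ K := by simp [K, hiq, hip, hiI]
        simp only [dilateAt, hiK, if_true, b', hiq, if_false, add_zero, smul_add, smul_smul]
        rw [show (1 - θ) * b i * (1 / (1 - θ)) = b i by field_simp, smul_sub]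
        abel
      · simp [hb'I i hiI, hbI i hiI]
    rw [Finset.sum_congr rfl fun i _ => h5 i, Finset.sum_add_distrib, Finset.sum_sub_distrib,
      ← Finset.sum_smul, ← Finset.sum_smul, hb1, hb's.2]
    abel
  have hsec : IsSectionPoint W I (dilateAt q (1 / (1 - θ)) K ω) b' :=
    ⟨hb's, hb'I, by rw [hsum]; exact hbW⟩
  refine ⟨⟨⟨f, β, h1, h2, fun i hi => ?_, fun j hj => ?_⟩, b', hsec⟩, b', hsec, hb'p, ?_, ?_⟩
  · unfold dilateAt
    split_ifs
    · rw [inner_add_right, inner_smul_right, inner_sub_right, h3 i hi, h3 q hq]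
      ring
    · exact h3 i hi
  · have : j ∉ K := fun h => hj (Finset.mem_of_mem_erase (Finset.mem_of_mem_erase h))
    simpa [dilateAt, this] using h4 j hj
  · simp only [b', if_true]
    nlinarith
  · simp only [b', if_true]
    nlinarith

/-- Small coordinates can be made larger at little cost. -/
theorem exp_mul_jointGaussian_coordSet_le {n d : ℕ} {m : Fin n → Euc d} {σ ρ η θ : ℝ}
    (hm : ∀ i, ‖m i‖ ≤ 1) (hρ1 : ρ ≤ 1) {W : Submodule ℝ (Euc d)} {w w' : Euc d}
    {I : Finset (Fin n)} {p q : Fin n} (hp : p ∈ I) (hq : q ∈ I) (hpq : p ≠ q)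
    (hθ0 : 0 ≤ θ) (hθ1 : θ ≤ 1 / 2) :
    ENNReal.ofReal (Real.exp (-(I.card * ((2 * ρ * (8 * θ) + (8 * θ) ^ 2) / (2 * σ ^ 2))))) *
      jointGaussian n d m σ ((gapSet W w w' I 0 ∩ coordSet W I p q 0 η) ∩ nearSet m ρ) ≤
      jointGaussian n d m σ (gapSet W w w' I 0 ∩ coordSet W I p q θ (θ + η)) := by
  classical
  have hθ : 0 < 1 - θ := by linarith
  refine ofReal_mul_jointGaussian_le (Real.exp_nonneg _)
    (T := dilateAt q (1 / (1 - θ)) ((I.erase p).erase q)) (measurable_dilateAt ..)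
    (map_dilateAt_volume_le ?_ _ (by simp))
    (((measurableSet_gapSet W w w' I 0).inter (isClosed_coordSet W I p q 0 η).measurableSet).inter
      (measurableSet_nearSet m ρ))
    ((measurableSet_gapSet W w w' I 0).inter (isClosed_coordSet W I p q θ (θ + η)).measurableSet)
    (fun ω hω => dilateAt_mem hp hq hpq hθ0 (by linarith) hω.1) ?_
  · rw [le_div_iff₀ hθ]
    linarith
  · rintro ω ⟨-, hω⟩
    have hω2 : ∀ i, ‖ω i‖ ≤ 2 := fun i => by
      have : ω i = (ω i - m i) + m i := by abel
      rw [this]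
      exact (norm_add_le _ _).trans (by linarith [hω i, hm i])
    refine exp_mul_prod_gaussPdf_le I (fun i hi => ?_) hω fun i => ?_
    · have : i ∉ (I.erase p).erase q :=
        fun h => hi (Finset.mem_of_mem_erase (Finset.mem_of_mem_erase h))
      simp [dilateAt, hi]
    · unfold dilateAt
      split_ifs
      · have h5 : ω q + (1 / (1 - θ)) • (ω i - ω q) - ω i =
            (1 / (1 - θ) - 1) • (ω i - ω q) := by
          rw [sub_smul, one_smul]
          abel
        have h6 : 1 / (1 - θ) - 1 = θ / (1 - θ) := by
          field_simp
          ring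
        have h7 : θ / (1 - θ) ≤ 2 * θ := by
          rw [div_le_iff₀ hθ]
          nlinarith
        have h8 : ‖ω i - ω q‖ ≤ 4 := (norm_sub_le _ _).trans (by linarith [hω2 i, hω2 q])
        rw [h5, h6, norm_smul, Real.norm_of_nonneg (by positivity)]
        calc θ / (1 - θ) * ‖ω i - ω q‖ ≤ 2 * θ * 4 := by gcongr
          _ = 8 * θ := by ring
      · simpa using hθ0

theorem IsSectionPoint.eq_of_linearIndepOn {n d : ℕ} {W : Submodule ℝ (Euc d)}
    {J : Finset (Fin n)} {ω : Fin n → Euc d} {b b' : Fin n → ℝ}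
    (hlin : LinearIndepOn ℝ (fun i => ((1 : ℝ), Wᗮ.orthogonalProjectionOnto (ω i))) (J : Set (Fin n)))
    (hb : IsSectionPoint W J ω b) (hb' : IsSectionPoint W J ω b') : b = b' := by
  have hproj : ∀ b, IsSectionPoint W J ω b →
      ∑ i ∈ J, b i • ((1 : ℝ), Wᗮ.orthogonalProjectionOnto (ω i)) = ((1 : ℝ), 0) := by
    rintro b ⟨hs, hJ, hW⟩
    have h1 : ∑ i ∈ J, b i = 1 := by
      rw [← hs.2]
      exact Finset.sum_subset (Finset.subset_univ J) fun i _ hi => hJ i hi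
    have h2 : ∑ i ∈ J, b i • ω i = ∑ i, b i • ω i :=
      Finset.sum_subset (Finset.subset_univ J) fun i _ hi => by simp [hJ i hi]
    have h3 : ∑ i ∈ J, b i • Wᗮ.orthogonalProjectionOnto (ω i) = 0 := by
      simp only [← map_smul, ← map_sum, h2]
      rw [Submodule.orthogonalProjectionOnto_eq_zero_iff, Submodule.orthogonal_orthogonal]
      exact hW
    ext1
    · simpa [Prod.fst_sum] using h1
    · simpa [Prod.snd_sum] using h3
  have h4 : ∑ i ∈ J, (b i - b' i) • ((1 : ℝ), Wᗮ.orthogonalProjectionOnto (ω i)) = 0 := by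
    simp only [sub_smul, Finset.sum_sub_distrib]
    rw [hproj b hb, hproj b' hb', sub_self]
  have h5 := linearIndepOn_finset_iff.1 hlin (fun i => b i - b' i) h4
  ext i
  by_cases hi : i ∈ J
  · exact sub_eq_zero.1 (h5 i hi)
  · rw [hb.2.1 i hi, hb'.2.1 i hi]

/-- General position of the points relative to `W`. -/
def IsGeneric {n d : ℕ} (W : Submodule ℝ (Euc d)) (ω : Fin n → Euc d) : Prop :=
  (∀ S : Finset (Fin n), S.card + 1 ≤ d →
    LinearIndepOn ℝ (fun i => ((1 : ℝ), Wᗮ.orthogonalProjectionOnto (ω i))) (S : Set (Fin n))) ∧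
  ∀ S : Finset (Fin n), S.card ≤ d + 1 →
    LinearIndepOn ℝ (fun i => ((1 : ℝ), ω i)) (S : Set (Fin n))

theorem ae_isGeneric {n d : ℕ} (m : Fin n → Euc d) (σ : ℝ) {W : Submodule ℝ (Euc d)}
    (hW : Module.finrank ℝ W = 2) : ∀ᵐ ω ∂(jointGaussian n d m σ), IsGeneric W ω := by
  have hac : jointGaussian n d m σ ≪ volume := withDensity_absolutelyContinuous _ _
  refine hac.ae_le ?_
  have hfin := W.finrank_add_finrank_orthogonal
  rw [hW, finrank_euclideanSpace, Fintype.card_fin] at hfin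
  refine (ae_all_iff.2 fun S => ?_).and (ae_all_iff.2 fun S => ?_)
  · by_cases hS : S.card + 1 ≤ d
    · filter_upwards [ae_linearIndepOn Wᗮ.orthogonalProjectionOnto
        (fun x => ⟨x, by simp⟩) S (by omega)] with ω hω _ using hω
    · exact Filter.Eventually.of_forall fun ω h => absurd h hS
  · by_cases hS : S.card ≤ d + 1
    · filter_upwards [ae_linearIndepOn (ContinuousLinearMap.id ℝ (Euc d))
        Function.surjective_id S (by simpa using hS)] with ω hω _ using hω
    · exact Filter.Eventually.of_forall fun ω h => absurd h hS

theorem IsGeneric.sectionPoint_unique {n d : ℕ} {W : Submodule ℝ (Euc d)} {ω : Fin n → Euc d}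
    (hω : IsGeneric W ω) {I : Finset (Fin n)} (hI : I.card = d) {p : Fin n} (hp : p ∈ I)
    {b b' : Fin n → ℝ} (hb : IsSectionPoint W I ω b) (hb' : IsSectionPoint W I ω b')
    (hbp : b p = 0) (hbp' : b' p = 0) : b = b' := by
  classical
  have h1 : ∀ b, IsSectionPoint W I ω b → b p = 0 → IsSectionPoint W (I.erase p) ω b := by
    rintro b ⟨h1, h2, h3⟩ h4
    refine ⟨h1, fun i hi => ?_, h3⟩
    by_cases hip : i = p
    · rw [hip, h4]
    · exact h2 i fun h => hi (Finset.mem_erase.2 ⟨hip, h⟩)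
  refine IsSectionPoint.eq_of_linearIndepOn (hω.1 (I.erase p) ?_) (h1 b hb hbp) (h1 b' hb' hbp')
  rw [Finset.card_erase_add_one hp, hI]

/-- Facets meeting `W` at a point with a small coordinate are rare. -/
theorem natCast_mul_jointGaussian_coordSet_le {n d : ℕ} {m : Fin n → Euc d} {σ ρ η : ℝ}
    (hm : ∀ i, ‖m i‖ ≤ 1) (hρ0 : 0 ≤ ρ) (hρ1 : ρ ≤ 1) {W : Submodule ℝ (Euc d)}
    (hW : Module.finrank ℝ W = 2) {w w' : Euc d} {I : Finset (Fin n)} (hI : I.card = d)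
    {p q : Fin n} (hp : p ∈ I) (hq : q ∈ I) (hpq : p ≠ q) (hη : 0 < η) (N : ℕ)
    (hN : 2 * N * η ≤ 1 / 2)
    (hNσ : d * ((2 * ρ * (16 * N * η) + (16 * N * η) ^ 2) / (2 * σ ^ 2)) ≤ 1 / 2) :
    N * jointGaussian n d m σ ((gapSet W w w' I 0 ∩ coordSet W I p q 0 η) ∩ nearSet m ρ) ≤
      2 * jointGaussian n d m σ (gapSet W w w' I 0) := by
  set μ := jointGaussian n d m σ
  set E := (gapSet W w w' I 0 ∩ coordSet W I p q 0 η) ∩ nearSet m ρ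
  let B : ℕ → Set (Fin n → Euc d) := fun k =>
    gapSet W w w' I 0 ∩ coordSet W I p q (2 * k * η) (2 * k * η + η)
  have hB : ∀ k, MeasurableSet (B k) := fun k =>
    (measurableSet_gapSet W w w' I 0).inter (isClosed_coordSet ..).measurableSet
  have h1 : ∀ k ∈ Finset.range N, μ E ≤ 2 * μ (B k) := by
    intro k hk
    have hkN : (k : ℝ) ≤ N := by exact_mod_cast (Finset.mem_range.1 hk).le
    have hθ : 2 * k * η ≤ 2 * N * η := by gcongr
    have h2 := exp_mul_jointGaussian_coordSet_le (σ := σ) hm hρ1 (w := w) (w' := w') (W := W)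
      hp hq hpq (η := η) (θ := 2 * k * η) (by positivity) (by linarith)
    have h3 : (1 / 2 : ℝ) ≤ Real.exp (-(I.card * ((2 * ρ * (8 * (2 * k * η)) +
        (8 * (2 * k * η)) ^ 2) / (2 * σ ^ 2)))) := by
      have h4 : I.card * ((2 * ρ * (8 * (2 * k * η)) + (8 * (2 * k * η)) ^ 2) / (2 * σ ^ 2)) ≤
          d * ((2 * ρ * (16 * N * η) + (16 * N * η) ^ 2) / (2 * σ ^ 2)) := by
        have h8 : 8 * (2 * k * η) ≤ 16 * N * η := by linarith
        rw [hI]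
        have h9 : 0 ≤ 8 * (2 * k * η) := by positivity
        generalize 8 * (2 * k * η) = x at h8 h9 ⊢
        generalize 16 * N * η = y at h8 ⊢
        gcongr
      have h5 := Real.add_one_le_exp (-(I.card * ((2 * ρ * (8 * (2 * k * η)) +
        (8 * (2 * k * η)) ^ 2) / (2 * σ ^ 2))))
      linarith
    calc μ E = 2 * (ENNReal.ofReal (1 / 2) * μ E) := by
          have h4 : (2 : ℝ≥0∞) * ENNReal.ofReal (1 / 2) = 1 := by
            rw [← ENNReal.ofReal_ofNat 2, ← ENNReal.ofReal_mul (by norm_num)]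
            norm_num
          rw [← mul_assoc, h4, one_mul]
      _ ≤ 2 * μ (B k) := by
          gcongr
          refine le_trans ?_ h2
          gcongr
  have hdisj : Set.Pairwise ↑(Finset.range N) (Function.onFun (AEDisjoint μ) B) := by
    intro k _ l _ hkl
    refine measure_mono_null (t := {ω | ¬ IsGeneric W ω}) ?_ (ae_isGeneric m σ hW)
    rintro ω ⟨⟨-, b, hb, hbp, hb1, hb2⟩, -, b', hb', hbp', hb1', hb2'⟩ hω
    have heq := hω.sectionPoint_unique hI hp hb hb' hbp hbp'
    subst heq
    rcases lt_or_gt_of_ne hkl with h | h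
    · have : (k : ℝ) + 1 ≤ l := by exact_mod_cast h
      nlinarith
    · have : (l : ℝ) + 1 ≤ k := by exact_mod_cast h
      nlinarith
  calc N * μ E = ∑ k ∈ Finset.range N, μ E := by simp
    _ ≤ ∑ k ∈ Finset.range N, 2 * μ (B k) := Finset.sum_le_sum h1
    _ = 2 * μ (⋃ k ∈ Finset.range N, B k) := by
        rw [← Finset.mul_sum, measure_biUnion_finset₀ hdisj fun k _ => (hB k).nullMeasurableSet]
    _ ≤ 2 * μ (gapSet W w w' I 0) := by
        gcongr
        exact iUnion₂_subset fun k _ => inter_subset_left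

/-- Separated reals in an interval are few. -/
theorem card_le_of_pairwise_dist {α : Type*} (G : Finset α) (s : α → ℝ) {D R : ℝ} (hD : 0 < D)
    (hs : ∀ x ∈ G, |s x| ≤ R) (hsep : ∀ x ∈ G, ∀ y ∈ G, x ≠ y → D ≤ |s x - s y|)
    (hR : 0 ≤ R) :
    (G.card : ℝ) ≤ 1 + 2 * R / D := by
  classical
  have hnn : ∀ x ∈ G, 0 ≤ (s x + R) / D := fun x hx =>
    div_nonneg (by linarith [(abs_le.1 (hs x hx)).1]) hD.le
  have h1 : G.card ≤ (Finset.range (⌊2 * R / D⌋₊ + 1)).card := by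
    refine Finset.card_le_card_of_injOn (fun x => ⌊(s x + R) / D⌋₊) (fun x hx => ?_) ?_
    · simp only [Finset.coe_range, mem_Iio, Nat.lt_succ_iff]
      refine Nat.floor_le_floor ?_
      gcongr
      linarith [(abs_le.1 (hs x hx)).2]
    · intro x hx y hy hxy
      by_contra hne
      have h2 := hsep x hx y hy hne
      have hxy' : ⌊(s x + R) / D⌋₊ = ⌊(s y + R) / D⌋₊ := hxy
      have h3 := Nat.floor_le (hnn x hx)
      have h4 := Nat.lt_floor_add_one ((s x + R) / D)
      have h5 := Nat.floor_le (hnn y hy)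
      have h6 := Nat.lt_floor_add_one ((s y + R) / D)
      rw [hxy'] at h3 h4
      have h7 : |(s x + R) / D - (s y + R) / D| < 1 := by
        rw [abs_lt]
        constructor <;> linarith
      rw [← sub_div, abs_div, abs_of_pos hD, div_lt_one hD] at h7
      have h8 : s x + R - (s y + R) = s x - s y := by ring
      rw [h8] at h7
      linarith
  rw [Finset.card_range] at h1
  have h9 : ((⌊2 * R / D⌋₊ : ℕ) : ℝ) ≤ 2 * R / D := Nat.floor_le (by positivity)
  have h10 : (G.card : ℝ) ≤ (⌊2 * R / D⌋₊ : ℕ) + 1 := by exact_mod_cast h1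
  linarith

theorem exists_add_mul_eq_zero {ι : Type*} [Fintype ι] {b c : ι → ℝ} (hb : ∀ i, 0 ≤ b i)
    (hc : ∃ i, c i < 0) :
    ∃ t : ℝ, ∃ p, c p < 0 ∧ b p + t * c p = 0 ∧ ∀ i, 0 ≤ b i + t * c i := by
  classical
  obtain ⟨i, hi⟩ := hc
  obtain ⟨p, hp, hmin⟩ := Finset.exists_min_image (Finset.univ.filter fun i => c i < 0)
    (fun i => b i / -c i) ⟨i, by simpa using hi⟩
  simp only [Finset.mem_filter, Finset.mem_univ, true_and] at hp hmin
  refine ⟨b p / -c p, p, hp, ?_, fun i => ?_⟩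
  · field_simp [hp.ne]
    ring
  · have ht : 0 ≤ b p / -c p := div_nonneg (hb p) (by linarith)
    by_cases hi : c i < 0
    · have := hmin i hi
      rw [le_div_iff₀ (by linarith)] at this
      linarith
    · have := hb i
      have := mul_nonneg ht (not_lt.1 hi)
      linarith

theorem exists_relation {n d : ℕ} {W : Submodule ℝ (Euc d)} (hW : Module.finrank ℝ W = 2)
    (ω : Fin n → Euc d) {I : Finset (Fin n)} (hI : I.card = d) :
    ∃ c : Fin n → ℝ, (∀ i ∉ I, c i = 0) ∧ ∑ i, c i = 0 ∧ ∑ i, c i • ω i ∈ W ∧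
      ∃ i, c i ≠ 0 := by
  classical
  have hfin := W.finrank_add_finrank_orthogonal
  rw [hW, finrank_euclideanSpace, Fintype.card_fin] at hfin
  have hdep : ¬ LinearIndepOn ℝ (fun i => ((1 : ℝ), Wᗮ.orthogonalProjectionOnto (ω i)))
      (I : Set (Fin n)) := by
    intro h
    have h1 := LinearIndependent.fintype_card_le_finrank h
    rw [Module.finrank_prod, Module.finrank_self] at h1
    simp only [Finset.coe_sort_coe, Fintype.card_coe] at h1
    omega
  rw [linearIndepOn_finset_iff] at hdep
  push Not at hdep
  obtain ⟨g, hg, j, hj, hgj⟩ := hdep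
  refine ⟨fun i => if i ∈ I then g i else 0, fun i hi => by simp [hi], ?_, ?_, j, by simp [hj, hgj]⟩
  · have := congrArg Prod.fst hg
    simpa [Prod.fst_sum] using this
  · have h2 := congrArg Prod.snd hg
    simp only [Prod.snd_sum, Prod.smul_snd, Prod.snd_zero, ← map_smul, ← map_sum] at h2
    rw [Submodule.orthogonalProjectionOnto_eq_zero_iff, Submodule.orthogonal_orthogonal] at h2
    simpa [ite_smul] using h2

/-- A facet without small coordinates meets `W` at a point with all coordinates large. -/
theorem exists_sectionPoint_half_le {n d : ℕ} {W : Submodule ℝ (Euc d)}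
    (hW : Module.finrank ℝ W = 2) {ω : Fin n → Euc d} {I : Finset (Fin n)}
    (hI : I.card = d) {η : ℝ} (hsec : ∃ b, IsSectionPoint W I ω b)
    (hcoord : ∀ p ∈ I, ∀ q ∈ I, p ≠ q → ω ∉ coordSet W I p q 0 η) :
    ∃ b, IsSectionPoint W I ω b ∧ ∀ i ∈ I, η / 2 ≤ b i := by
  obtain ⟨b, ⟨hb0, hb1⟩, hbI, hbW⟩ := hsec
  obtain ⟨c, hcI, hc0, hcW, j, hj⟩ := exists_relation hW ω hI
  have hend : ∀ c : Fin n → ℝ, (∀ i ∉ I, c i = 0) → ∑ i, c i = 0 → ∑ i, c i • ω i ∈ W →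
      (∃ i, c i < 0) → ∃ b' p, c p < 0 ∧ IsSectionPoint W I ω b' ∧
        ∀ q ∈ I, q ≠ p → η ≤ b' q := by
    intro c hcI hc0 hcW hneg
    obtain ⟨t, p, hp, hp0, hnn⟩ := exists_add_mul_eq_zero hb0 hneg
    have hpI : p ∈ I := by
      by_contra h
      exact hp.ne (hcI p h)
    have hs : IsSectionPoint W I ω fun i => b i + t * c i := by
      refine ⟨⟨hnn, ?_⟩, fun i hi => by simp [hbI i hi, hcI i hi], ?_⟩
      · rw [Finset.sum_add_distrib, ← Finset.mul_sum, hb1, hc0]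
        simp
      · simp only [add_smul, mul_smul, Finset.sum_add_distrib, ← Finset.smul_sum]
        exact W.add_mem hbW (W.smul_mem t hcW)
    refine ⟨_, p, hp, hs, fun q hq hqp => ?_⟩
    by_contra! h
    exact hcoord p hpI q hq hqp.symm ⟨_, hs, hp0, hnn q, h.le⟩
  have hneg : ∃ i, c i < 0 := by
    by_contra! h
    exact hj ((Finset.sum_eq_zero_iff_of_nonneg fun i _ => h i).1 hc0 j (Finset.mem_univ j))
  have hpos : ∃ i, -c i < 0 := by
    by_contra! h
    have h' : ∑ i, -c i = 0 := by rw [Finset.sum_neg_distrib, hc0, neg_zero]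
    have := (Finset.sum_eq_zero_iff_of_nonneg fun i _ => h i).1 h' j (Finset.mem_univ j)
    exact hj (neg_eq_zero.1 this)
  obtain ⟨b₁, p₁, hp₁, hs₁, hq₁⟩ := hend c hcI hc0 hcW hneg
  obtain ⟨b₂, p₂, hp₂, hs₂, hq₂⟩ := hend (fun i => -c i) (fun i hi => by simp [hcI i hi])
    (by rw [Finset.sum_neg_distrib, hc0, neg_zero])
    (by simpa only [neg_smul, Finset.sum_neg_distrib] using W.neg_mem hcW) hpos
  refine ⟨fun i => (1 / 2 : ℝ) * b₁ i + (1 / 2 : ℝ) * b₂ i, ⟨?_, fun i hi => ?_, ?_⟩,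
    fun i hi => ?_⟩
  · exact convex_stdSimplex ℝ (Fin n) hs₁.1 hs₂.1 (by norm_num) (by norm_num) (by norm_num)
  · simp [hs₁.2.1 i hi, hs₂.2.1 i hi]
  · simp only [add_smul, mul_smul, Finset.sum_add_distrib, ← Finset.smul_sum]
    exact W.add_mem (W.smul_mem _ hs₁.2.2) (W.smul_mem _ hs₂.2.2)
  · have h1 := hs₁.1.1 i
    have h2 := hs₂.1.1 i
    by_cases hip : i = p₁
    · have : i ≠ p₂ := by
        rintro rfl
        subst hip
        linarith
      linarith [hq₂ i hi this]
    · linarith [hq₁ i hi hip]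

theorem IsSupport.inner_sum_eq {n d : ℕ} {W : Submodule ℝ (Euc d)} {w w' : Euc d}
    {I : Finset (Fin n)} {δ : ℝ} {ω : Fin n → Euc d} {f : Euc d} {β : ℝ}
    (hf : IsSupport w w' I δ ω f β) {b : Fin n → ℝ} (hb : IsSectionPoint W I ω b) :
    ⟪f, ∑ i, b i • ω i⟫ = β := by
  have h1 : ∀ i, b i * ⟪f, ω i⟫ = b i * β := by
    intro i
    by_cases hi : i ∈ I
    · rw [hf.2.2.1 i hi]
    · simp [hb.2.1 i hi]
  simp only [inner_sum, inner_smul_right, h1]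
  rw [← Finset.sum_mul, hb.1.2, one_mul]

theorem IsSupport.inner_sum_le {n d : ℕ} {W : Submodule ℝ (Euc d)} {w w' : Euc d}
    {I I' : Finset (Fin n)} {δ : ℝ} (hδ : 0 ≤ δ) {ω : Fin n → Euc d} {f : Euc d} {β : ℝ}
    (hf : IsSupport w w' I δ ω f β) {b : Fin n → ℝ} (hb : IsSectionPoint W I' ω b)
    {j : Fin n} (hj : j ∉ I) :
    ⟪f, ∑ i, b i • ω i⟫ ≤ β - δ * b j := by
  classical
  have h1 : ∀ i, b i * ⟪f, ω i⟫ ≤ b i * β - if i = j then δ * b j else 0 := by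
    intro i
    have hi0 := hb.1.1 i
    by_cases hij : i = j
    · subst hij
      have := mul_le_mul_of_nonneg_left (hf.2.2.2 i hj) hi0
      simp only [if_true]
      linarith
    · simp only [hij, if_false, sub_zero]
      refine mul_le_mul_of_nonneg_left ?_ hi0
      by_cases hi : i ∈ I
      · exact (hf.2.2.1 i hi).le
      · linarith [hf.2.2.2 i hi]
  simp only [inner_sum, inner_smul_right]
  refine (Finset.sum_le_sum fun i _ => h1 i).trans ?_
  rw [Finset.sum_sub_distrib, ← Finset.sum_mul, hb.1.2]
  simp

/-- The facet indexed by `I` meets `W`, with gap `δ` and away from points of `W` having one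
vanishing and another small coordinate. -/
def goodSet {n d : ℕ} (W : Submodule ℝ (Euc d)) (w w' : Euc d) (I : Finset (Fin n)) (δ η : ℝ) :
    Set (Fin n → Euc d) :=
  gapSet W w w' I δ \ ⋃ p ∈ I, ⋃ q ∈ I.erase p, coordSet W I p q 0 η

/-- Only few facets are well separated. -/
theorem card_goodSet_le {n d : ℕ} {W : Submodule ℝ (Euc d)} (hW : Module.finrank ℝ W = 2)
    {w w' : Euc d} (hw' : ‖w'‖ = 1)
    (hspan : ∀ z ∈ W, z = ⟪w, z⟫ • w + ⟪w', z⟫ • w') {ω : Fin n → Euc d}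
    (hω : ∀ i, ‖ω i‖ ≤ 2) {δ η : ℝ} (hδ : 0 < δ) (hη : 0 < η) (G : Finset (Finset (Fin n)))
    (hG : ∀ I ∈ G, I.card = d ∧ ω ∈ goodSet W w w' I δ η) :
    (G.card : ℝ) ≤ 1 + 3 / Real.sqrt (η * δ) := by
  classical
  have hdata : ∀ I ∈ G, ∃ f β b, IsSupport w w' I δ ω f β ∧ IsSectionPoint W I ω b ∧
      ∀ i ∈ I, η / 2 ≤ b i := by
    intro I hIG
    obtain ⟨hI, ⟨⟨f, β, hf⟩, hb⟩, hcoord⟩ := hG I hIG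
    simp only [mem_iUnion, not_exists, Finset.mem_erase] at hcoord
    obtain ⟨b, hb, hbη⟩ := exists_sectionPoint_half_le hW hI hb
      fun p hp q hq hpq => hcoord p hp q ⟨hpq.symm, hq⟩
    exact ⟨f, β, b, hf, hb, hbη⟩
  choose! f β b hf hb hbη using hdata
  let v : Finset (Fin n) → Euc d := fun I => ∑ i, b I i • ω i
  have hvnorm : ∀ I ∈ G, |⟪w', v I⟫| ≤ 2 := by
    intro I hI
    refine (abs_real_inner_le_norm _ _).trans ?_
    rw [hw', one_mul]
    calc ‖v I‖ ≤ ∑ i, ‖b I i • ω i‖ := norm_sum_le _ _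
      _ ≤ ∑ i, b I i * 2 := by
          refine Finset.sum_le_sum fun i _ => ?_
          have h1 := (hb I hI).1.1 i
          rw [norm_smul, Real.norm_of_nonneg h1]
          exact mul_le_mul_of_nonneg_left (hω i) h1
      _ = 2 := by rw [← Finset.sum_mul, (hb I hI).1.2, one_mul]
  have hin : ∀ I ∈ G, ∀ z ∈ W, ⟪f I, z⟫ = ⟪w, z⟫ + ⟪f I, w'⟫ * ⟪w', z⟫ := by
    intro I hI z hz
    conv_lhs => rw [hspan z hz]
    rw [inner_add_right, inner_smul_right, inner_smul_right, (hf I hI).1]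
    ring
  have hkey : ∀ I ∈ G, ∀ I' ∈ G, I ≠ I' →
      η * δ ≤ (⟪f I, w'⟫ - ⟪f I', w'⟫) * (⟪w', v I⟫ - ⟪w', v I'⟫) := by
    have hlow : ∀ I ∈ G, ∀ I' ∈ G, I ≠ I' → ⟪f I, v I'⟫ ≤ β I - δ * (η / 2) := by
      intro I hI I' hI' hne
      obtain ⟨j, hj', hj⟩ : ∃ j ∈ I', j ∉ I := by
        by_contra! h
        exact hne (Finset.eq_of_subset_of_card_le h (by rw [(hG I hI).1, (hG I' hI').1])).symm
      refine ((hf I hI).inner_sum_le hδ.le (hb I' hI') hj).trans ?_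
      have := mul_le_mul_of_nonneg_left (hbη I' hI' j hj') hδ.le
      linarith
    intro I hI I' hI' hne
    have h1 := hlow I hI I' hI' hne
    have h2 := hlow I' hI' I hI hne.symm
    have h3 := (hf I hI).inner_sum_eq (hb I hI)
    have h4 := (hf I' hI').inner_sum_eq (hb I' hI')
    change ⟪f I, v I⟫ = β I at h3
    change ⟪f I', v I'⟫ = β I' at h4
    have hvI : v I ∈ W := (hb I hI).2.2
    have hvI' : v I' ∈ W := (hb I' hI').2.2
    rw [← h3, hin I hI _ hvI, hin I hI _ hvI'] at h1
    rw [← h4, hin I' hI' _ hvI, hin I' hI' _ hvI'] at h2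
    linarith
  have hγ : 0 < Real.sqrt (η * δ) := Real.sqrt_pos.2 (by positivity)
  have hcard := card_le_of_pairwise_dist G (fun I => ⟪f I, w'⟫ + ⟪w', v I⟫)
    (D := 2 * Real.sqrt (η * δ)) (R := 3) (by positivity) (fun I hI => ?_)
    (fun I hI I' hI' hne => ?_) (by norm_num)
  · refine hcard.trans (le_of_eq ?_)
    congr 1
    field_simp
  · refine (abs_add_le _ _).trans ?_
    linarith [(hf I hI).2.1, hvnorm I hI]
  · have h1 := hkey I hI I' hI' hne
    rw [← Real.sqrt_sq_eq_abs]
    refine Real.le_sqrt_of_sq_le ?_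
    rw [mul_pow, Real.sq_sqrt (by positivity)]
    nlinarith [sq_nonneg ((⟪f I, w'⟫ - ⟪f I', w'⟫) - (⟪w', v I⟫ - ⟪w', v I'⟫))]

theorem exists_inner_nonpos_of_zero_notMem {d : ℕ} {D : Set (Euc d)} (hD : Convex ℝ D)
    (hne : D.Nonempty) (h0 : (0 : Euc d) ∉ D) :
    ∃ f : Euc d, f ≠ 0 ∧ ∀ a ∈ D, ⟪f, a⟫ ≤ 0 := by
  by_cases hDint : (interior D).Nonempty
  · obtain ⟨l, hl, hla⟩ := geometric_hahn_banach_of_nonempty_interior_point hD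
      (fun h => h0 (interior_subset h)) hDint
    refine ⟨(InnerProductSpace.toDual ℝ (Euc d)).symm l, by simpa using hl, fun a ha => ?_⟩
    simpa using hla a ha
  · rw [hD.interior_nonempty_iff_affineSpan_eq_top] at hDint
    have hdir : (affineSpan ℝ D).direction ≠ ⊤ := fun h =>
      hDint ((AffineSubspace.direction_eq_top_iff_of_nonempty
        ((affineSpan_nonempty ℝ).2 hne)).1 h)
    obtain ⟨g, hg, hg0⟩ := Submodule.exists_mem_ne_zero_of_ne_bot
      (mt Submodule.orthogonal_eq_bot_iff.1 hdir)
    obtain ⟨x, hx⟩ := hne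
    have hconst : ∀ a ∈ D, ⟪g, a⟫ = ⟪g, x⟫ := by
      intro a ha
      have h1 : a -ᵥ x ∈ (affineSpan ℝ D).direction := AffineSubspace.vsub_mem_direction
        (subset_affineSpan ℝ D ha) (subset_affineSpan ℝ D hx)
      have h2 := (Submodule.mem_orthogonal' _ _).1 hg _ h1
      rw [vsub_eq_sub, inner_sub_right] at h2
      linarith
    rcases le_total ⟪g, x⟫ 0 with h | h
    · exact ⟨g, hg0, fun a ha => (hconst a ha).trans_le h⟩
    · exact ⟨-g, neg_ne_zero.2 hg0, fun a ha => by rw [inner_neg_left, hconst a ha]; linarith⟩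

theorem mem_convexHull_range_iff {n d : ℕ} {ω : Fin n → Euc d} {z : Euc d} :
    z ∈ convexHull ℝ (Set.range ω) ↔ ∃ b ∈ stdSimplex ℝ (Fin n), ∑ i, b i • ω i = z := by
  classical
  constructor
  · let φ : (Fin n → ℝ) →ₗ[ℝ] Euc d := Fintype.linearCombination ℝ ω
    have h1 : convexHull ℝ (Set.range ω) ⊆ φ '' stdSimplex ℝ (Fin n) := by
      refine convexHull_min ?_ ((convex_stdSimplex ℝ (Fin n)).linear_image φ)
      rintro _ ⟨i, rfl⟩
      exact ⟨Pi.single i 1, single_mem_stdSimplex ℝ i, by simp [φ]⟩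
    intro hz
    obtain ⟨b, hb, rfl⟩ := h1 hz
    exact ⟨b, hb, by simp [φ, Fintype.linearCombination_apply]⟩
  · rintro ⟨b, hb, rfl⟩
    exact (convex_convexHull ℝ _).sum_mem (fun i _ => hb.1 i) hb.2
      fun i _ => subset_convexHull ℝ _ ⟨i, rfl⟩

/-- An edge of a plane section is cut out by a nonzero vector of the plane. -/
theorem exists_normal_of_isExposed {d : ℕ} {W : Submodule ℝ (Euc d)}
    (hW : Module.finrank ℝ W = 2) {S F : Set (Euc d)} (hSW : S ⊆ W) (hF : IsExposed ℝ S F)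
    (hF1 : Module.finrank ℝ (vectorSpan ℝ F) = 1) (hne : F.Nonempty) :
    ∃ u ∈ W, ∃ c : ℝ, u ≠ 0 ∧ (∀ z ∈ S, ⟪u, z⟫ ≤ c) ∧ F = {z ∈ S | ⟪u, z⟫ = c} := by
  obtain ⟨l, hl⟩ := hF hne
  obtain ⟨x, hx⟩ := hne
  have hFS : F ⊆ S := hF.subset
  have hxl : ∀ y ∈ S, l y ≤ l x := by
    rw [hl] at hx
    exact hx.2
  have hFx : F = {z ∈ S | l z = l x} := by
    ext z
    constructor
    · intro hz
      have hz' := hz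
      rw [hl] at hz'
      exact ⟨hz'.1, le_antisymm (hxl z hz'.1) (hz'.2 x (hFS hx))⟩
    · rintro ⟨hz, hzx⟩
      rw [hl]
      exact ⟨hz, fun y hy => hzx ▸ hxl y hy⟩
  let g := (InnerProductSpace.toDual ℝ (Euc d)).symm l
  let u := W.orthogonalProjectionOnto g
  have hu : ∀ z ∈ W, ⟪(u : Euc d), z⟫ = l z := by
    intro z hz
    have h1 := W.inner_orthogonalProjectionOnto_eq_of_mem_right ⟨z, hz⟩ g
    have h2 : ⟪g, z⟫ = l z := by simp [g]
    exact h1.trans h2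
  by_cases hu0 : (u : Euc d) = 0
  · have hl0 : ∀ z ∈ W, l z = 0 := fun z hz => by rw [← hu z hz, hu0, inner_zero_left]
    have hFeq : F = S := by
      rw [hFx]
      ext z
      exact ⟨fun h => h.1, fun h => ⟨h, by rw [hl0 z (hSW h), hl0 x (hSW (hFS hx))]⟩⟩
    have hVW : vectorSpan ℝ F ≤ W := by
      rw [vectorSpan_def, Submodule.span_le]
      rintro _ ⟨a, ha, b, hb, rfl⟩
      exact W.sub_mem (hSW (hFS ha)) (hSW (hFS hb))
    have hex : ∃ v ∈ W, v ≠ 0 ∧ ∀ y ∈ vectorSpan ℝ F, ⟪v, y⟫ = 0 := by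
      have h3 := Submodule.finrank_add_inf_finrank_orthogonal hVW
      rw [hF1, hW] at h3
      have h4 : (vectorSpan ℝ F)ᗮ ⊓ W ≠ ⊥ := by
        intro h
        rw [h, finrank_bot] at h3
        omega
      obtain ⟨v, hv, hv0⟩ := Submodule.exists_mem_ne_zero_of_ne_bot h4
      exact ⟨v, hv.2, hv0, fun y hy => (Submodule.mem_orthogonal' _ _).1 hv.1 y hy⟩
    obtain ⟨v, hvW, hv0, hv⟩ := hex
    have hconst : ∀ z ∈ S, ⟪v, z⟫ = ⟪v, x⟫ := by
      intro z hz
      have := hv _ (vsub_mem_vectorSpan ℝ (hFeq ▸ hz) hx)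
      rw [vsub_eq_sub, inner_sub_right] at this
      linarith
    refine ⟨v, hvW, ⟪v, x⟫, hv0, fun z hz => (hconst z hz).le, ?_⟩
    rw [hFeq]
    ext z
    exact ⟨fun h => ⟨h, hconst z h⟩, fun h => h.1⟩
  · refine ⟨u, u.2, l x, hu0, fun z hz => (hu z (hSW hz)).trans_le (hxl z hz), ?_⟩
    rw [hFx]
    ext z
    exact ⟨fun h => ⟨h.1, (hu z (hSW h.1)).trans h.2⟩,
      fun h => ⟨h.1, (hu z (hSW h.1)).symm.trans h.2⟩⟩

/-- Extending a supporting line of a plane section to a supporting hyperplane. -/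
theorem exists_support_extending {d : ℕ} {W : Submodule ℝ (Euc d)} {P : Set (Euc d)}
    (hP : Convex ℝ P) {u : Euc d} (huW : u ∈ W) (hu : u ≠ 0)
    {c : ℝ} (hc : ∀ z ∈ P ∩ W, ⟪u, z⟫ ≤ c) {x : Euc d} (hx : x ∈ P ∩ W) (hxc : ⟪u, x⟫ = c) :
    ∃ f : Euc d, f ≠ 0 ∧ (∀ z ∈ P, ⟪f, z⟫ ≤ ⟪f, x⟫) ∧
      ∃ a : ℝ, ∀ z ∈ W, ⟪f, z⟫ = a * ⟪u, z⟫ := by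
  let Q : Set (Euc d) := {z | z ∈ W ∧ c < ⟪u, z⟫}
  have hQ : Convex ℝ Q := by
    have : Q = (W : Set (Euc d)) ∩ {z | c < ⟪u, z⟫} := rfl
    rw [this]
    exact W.convex.inter (convex_halfSpace_gt (innerSL ℝ u).isLinear c)
  have huu : 0 < ⟪u, u⟫ := real_inner_self_pos.2 hu
  have hmemQ : ∀ t : ℝ, 0 < t → ∀ z ∈ W, ⟪u, z⟫ = 0 → x + t • u + z ∈ Q := by
    intro t ht z hz huz
    refine ⟨W.add_mem (W.add_mem hx.2 (W.smul_mem t huW)) hz, ?_⟩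
    rw [inner_add_right, inner_add_right, inner_smul_right, huz, hxc]
    nlinarith
  obtain ⟨f, hf, hfD⟩ := exists_inner_nonpos_of_zero_notMem (hP.sub hQ)
    ⟨_, Set.sub_mem_sub hx.1 (hmemQ 1 one_pos 0 W.zero_mem (inner_zero_right _))⟩ (by
      rintro ⟨p, hp, q, hq, hpq⟩
      have : p = q := sub_eq_zero.1 hpq
      subst this
      exact absurd (hc p ⟨hp, hq.1⟩) (not_le.2 hq.2))
  have hsep : ∀ p ∈ P, ∀ q ∈ Q, ⟪f, p⟫ ≤ ⟪f, q⟫ := by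
    intro p hp q hq
    have := hfD _ (Set.sub_mem_sub hp hq)
    rw [inner_sub_right] at this
    linarith
  have hlim : ∀ p ∈ P, ∀ z ∈ W, ⟪u, z⟫ = 0 → ⟪f, p⟫ ≤ ⟪f, x⟫ + ⟪f, z⟫ := by
    intro p hp z hz huz
    have h1 : ∀ t : ℝ, 0 < t → ⟪f, p⟫ ≤ ⟪f, x⟫ + t * ⟪f, u⟫ + ⟪f, z⟫ := by
      intro t ht
      have := hsep p hp _ (hmemQ t ht z hz huz)
      rwa [inner_add_right, inner_add_right, inner_smul_right] at this
    refine le_of_forall_pos_le_add fun ε hε => ?_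
    have h2 := h1 (ε / (|⟪f, u⟫| + 1)) (by positivity)
    have h3 : ε / (|⟪f, u⟫| + 1) * ⟪f, u⟫ ≤ ε := by
      rw [div_mul_eq_mul_div, div_le_iff₀ (by positivity)]
      nlinarith [le_abs_self ⟪f, u⟫]
    linarith
  refine ⟨f, hf, fun p hp => ?_, ⟪f, u⟫ / ⟪u, u⟫, fun z hz => ?_⟩
  · simpa using hlim p hp 0 W.zero_mem (inner_zero_right _)
  · have hperp : ∀ y ∈ W, ⟪u, y⟫ = 0 → ⟪f, y⟫ = 0 := by
      intro y hy huy
      have h1 := hlim x hx.1 y hy huy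
      have h2 := hlim x hx.1 (-y) (W.neg_mem hy) (by rw [inner_neg_right, huy, neg_zero])
      rw [inner_neg_right] at h2
      linarith
    have h3 := hperp (z - (⟪u, z⟫ / ⟪u, u⟫) • u) (W.sub_mem hz (W.smul_mem _ huW)) (by
      rw [inner_sub_right, inner_smul_right]
      field_simp
      ring)
    rw [inner_sub_right, inner_smul_right] at h3
    rw [div_mul_eq_mul_div]
    rw [div_mul_eq_mul_div] at h3
    rw [mul_comm ⟪f, u⟫]
    linarith

theorem LinearIndepOn.eq_zero_of_card_eq_finrank {ι V : Type*} [AddCommGroup V] [Module ℝ V]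
    [FiniteDimensional ℝ V]
    {v : ι → V} {S : Finset ι} (hv : LinearIndepOn ℝ v (S : Set ι))
    (hS : S.card = Module.finrank ℝ V) {φ : V →ₗ[ℝ] ℝ} (hφ : ∀ i ∈ S, φ (v i) = 0) : φ = 0 := by
  have hspan := LinearIndependent.span_eq_top_of_card_eq_finrank' (b := fun i : (S : Set ι) => v i)
    hv (by simpa using hS)
  refine LinearMap.ext_on hspan ?_
  rintro _ ⟨i, rfl⟩
  simpa using hφ i i.2

theorem IsGeneric.eq_zero_of_forall_inner_eq {n d : ℕ} {W : Submodule ℝ (Euc d)}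
    {ω : Fin n → Euc d} (hω : IsGeneric W ω) {S : Finset (Fin n)} (hS : S.card = d + 1)
    {f : Euc d} {β : ℝ} (hf : ∀ i ∈ S, ⟪f, ω i⟫ = β) : f = 0 := by
  have h := (hω.2 S hS.le).eq_zero_of_card_eq_finrank (by simp [hS, add_comm])
    (φ := (innerSL ℝ f : Euc d →ₗ[ℝ] ℝ).comp (LinearMap.snd ℝ ℝ (Euc d)) -
      β • LinearMap.fst ℝ ℝ (Euc d)) (fun i hi => by simp [hf i hi])
  have h2 := LinearMap.congr_fun h (0, f)
  simpa using h2

theorem IsGeneric.eq_zero_of_mem_orthogonal {n d : ℕ} {W : Submodule ℝ (Euc d)}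
    (hW : Module.finrank ℝ W = 2) {ω : Fin n → Euc d} (hω : IsGeneric W ω) {S : Finset (Fin n)}
    (hS : S.card + 1 = d) {f : Euc d} (hfW : f ∈ Wᗮ) (hf : ∀ i ∈ S, ⟪f, ω i⟫ = 0) : f = 0 := by
  have hfin := W.finrank_add_finrank_orthogonal
  rw [hW, finrank_euclideanSpace, Fintype.card_fin] at hfin
  have h := (hω.1 S hS.le).eq_zero_of_card_eq_finrank
    (by rw [Module.finrank_prod, Module.finrank_self]; omega)
    (φ := ((innerSL ℝ (⟨f, hfW⟩ : Wᗮ)) : Wᗮ →ₗ[ℝ] ℝ).comp (LinearMap.snd ℝ ℝ Wᗮ)) (fun i hi => by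
      have h1 := Wᗮ.inner_orthogonalProjectionOnto_eq_of_mem_left ⟨f, hfW⟩ (ω i)
      exact h1.trans (hf i hi))
  have h2 : ⟪f, f⟫ = 0 := LinearMap.congr_fun h (0, ⟨f, hfW⟩)
  exact inner_self_eq_zero.1 h2

/-- In general position, an edge of the section comes from a facet with exactly `d` vertices. -/
theorem IsGeneric.exists_facet {n d : ℕ} {W : Submodule ℝ (Euc d)}
    (hW : Module.finrank ℝ W = 2) {ω : Fin n → Euc d} (hω : IsGeneric W ω) {F : Set (Euc d)}
    (hF : IsExposed ℝ (convexHull ℝ (Set.range ω) ∩ W) F)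
    (hF1 : Module.finrank ℝ (vectorSpan ℝ F) = 1) :
    ∃ J : Finset (Fin n), J.card = d ∧
      F = {z | ∃ b, IsSectionPoint W J ω b ∧ ∑ i, b i • ω i = z} ∧
      (∃ b, IsSectionPoint W J ω b) ∧
      ∃ f β, (∀ i ∈ J, ⟪f, ω i⟫ = β) ∧ (∀ j, ⟪f, ω j⟫ ≤ β) ∧ ∃ z ∈ W, ⟪f, z⟫ ≠ 0 := by
  classical
  have hnt : F.Nontrivial := by
    rw [← Set.not_subsingleton_iff]
    intro h
    rw [(vectorSpan_eq_bot_iff_subsingleton ℝ).2 h, finrank_bot] at hF1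
    omega
  obtain ⟨x, hx, y, hy, hxy⟩ := hnt
  obtain ⟨u, huW, c, hu0, huc, hFu⟩ :=
    exists_normal_of_isExposed hW Set.inter_subset_right hF hF1 ⟨x, hx⟩
  have hx' := hx
  rw [hFu] at hx'
  obtain ⟨f, hf0, hfP, a, hfa⟩ :=
    exists_support_extending (convex_convexHull ℝ _) huW hu0 huc hx'.1 hx'.2
  set β := ⟪f, x⟫ with hβ
  have hle : ∀ j, ⟪f, ω j⟫ ≤ β := fun j => hfP _ (subset_convexHull ℝ _ ⟨j, rfl⟩)
  let J : Finset (Fin n) := Finset.univ.filter fun j => ⟪f, ω j⟫ = β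
  have hJ : ∀ i ∈ J, ⟪f, ω i⟫ = β := fun i hi => (Finset.mem_filter.1 hi).2
  have hsupp : ∀ b ∈ stdSimplex ℝ (Fin n), ⟪f, ∑ i, b i • ω i⟫ = β → ∀ i ∉ J, b i = 0 := by
    intro b hb hbβ i hi
    have h1 : ∑ i, b i * (β - ⟪f, ω i⟫) = 0 := by
      simp_rw [mul_sub, Finset.sum_sub_distrib, ← Finset.sum_mul, hb.2]
      rw [← hbβ, inner_sum]
      simp [inner_smul_right]
    have h2 := (Finset.sum_eq_zero_iff_of_nonneg fun i _ =>
      mul_nonneg (hb.1 i) (sub_nonneg.2 (hle i))).1 h1 i (Finset.mem_univ i)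
    rcases mul_eq_zero.1 h2 with h | h
    · exact h
    · exact absurd (Finset.mem_filter.2 ⟨Finset.mem_univ i, by linarith⟩) hi
  have hFsub : ∀ z ∈ F, ∃ b, IsSectionPoint W J ω b ∧ ∑ i, b i • ω i = z := by
    intro z hz
    rw [hFu] at hz
    obtain ⟨b, hb, rfl⟩ := mem_convexHull_range_iff.1 hz.1.1
    refine ⟨b, ⟨hb, hsupp b hb ?_, hz.1.2⟩, rfl⟩
    rw [hfa _ hz.1.2, hz.2, hβ, hfa _ hx'.1.2, hx'.2]
  obtain ⟨b, hb, hbx⟩ := hFsub x hx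
  obtain ⟨b', hb', hbx'⟩ := hFsub y hy
  have hJd : d ≤ J.card := by
    by_contra h
    have := IsSectionPoint.eq_of_linearIndepOn (hω.1 J (by omega)) hb hb'
    exact hxy (by rw [← hbx, ← hbx', this])
  have hJd' : J.card ≤ d := by
    by_contra h
    obtain ⟨S, hSJ, hS⟩ := Finset.exists_subset_card_eq (show d + 1 ≤ J.card by omega)
    exact hf0 (hω.eq_zero_of_forall_inner_eq hS fun i hi => hJ i (hSJ hi))
  have ha : a ≠ 0 := by
    rintro rfl
    have hfW : f ∈ Wᗮ := (Submodule.mem_orthogonal' _ _).2 fun z hz => by rw [hfa z hz, zero_mul]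
    have hβ0 : β = 0 := by rw [hβ, hfa x hx'.1.2, zero_mul]
    have hd := W.finrank_add_finrank_orthogonal
    rw [hW, finrank_euclideanSpace, Fintype.card_fin] at hd
    obtain ⟨S, hSJ, hS⟩ := Finset.exists_subset_card_eq (show d - 1 ≤ J.card by omega)
    exact hf0 (hω.eq_zero_of_mem_orthogonal hW (by omega) hfW
      fun i hi => (hJ i (hSJ hi)).trans hβ0)
  refine ⟨J, le_antisymm hJd' hJd, ?_, ⟨b, hb⟩, f, β, hJ, hle, u, huW, ?_⟩
  · refine Set.Subset.antisymm hFsub ?_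
    rintro _ ⟨e, he, rfl⟩
    rw [hFu]
    refine ⟨⟨mem_convexHull_range_iff.2 ⟨e, he.1, rfl⟩, he.2.2⟩, ?_⟩
    have h1 : ⟪f, ∑ i, e i • ω i⟫ = β := by
      have h2 : ∀ i, e i * ⟪f, ω i⟫ = e i * β := by
        intro i
        by_cases hi : i ∈ J
        · rw [hJ i hi]
        · rw [he.2.1 i hi, zero_mul, zero_mul]
      simp_rw [inner_sum, inner_smul_right, h2, ← Finset.sum_mul, he.1.2, one_mul]
    rw [hfa _ he.2.2, hβ, hfa _ hx'.1.2, hx'.2] at h1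
    exact mul_left_cancel₀ ha h1
  · rw [hfa u huW]
    exact mul_ne_zero ha (inner_self_ne_zero.2 hu0)

/-- The number of facets of size `d` meeting `W` whose normal is dominated by `w`. -/
def facetCount {n d : ℕ} (W : Submodule ℝ (Euc d)) (w w' : Euc d) (ω : Fin n → Euc d) : ℕ :=
  {I : Finset (Fin n) | I.card = d ∧ ω ∈ gapSet W w w' I 0}.ncard

theorem mem_gapSet_of_support {n d : ℕ} {W : Submodule ℝ (Euc d)} {w w' : Euc d}
    {J : Finset (Fin n)} {ω : Fin n → Euc d} {b : Fin n → ℝ} (hb : IsSectionPoint W J ω b)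
    {f : Euc d} {β : ℝ} (hf : ∀ i ∈ J, ⟪f, ω i⟫ = β) (hfle : ∀ j, ⟪f, ω j⟫ ≤ β)
    (hfw : 0 < ⟪f, w⟫) (hfw' : |⟪f, w'⟫| ≤ ⟪f, w⟫) : ω ∈ gapSet W w w' J 0 := by
  have hs : ∀ z, ⟪(⟪f, w⟫)⁻¹ • f, z⟫ = (⟪f, w⟫)⁻¹ * ⟪f, z⟫ := fun z => real_inner_smul_left _ _ _
  refine ⟨⟨(⟪f, w⟫)⁻¹ • f, (⟪f, w⟫)⁻¹ * β, ?_, ?_, fun i hi => ?_, fun j _ => ?_⟩, b, hb⟩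
  · rw [hs, inv_mul_cancel₀ hfw.ne']
  · rw [hs, abs_mul, abs_of_pos (inv_pos.2 hfw), inv_mul_le_iff₀ hfw, mul_one]
    exact hfw'
  · rw [hs, hf i hi]
  · rw [hs, sub_zero]
    exact mul_le_mul_of_nonneg_left (hfle j) (inv_pos.2 hfw).le

theorem IsGeneric.edgeCount_le {n d : ℕ} {W : Submodule ℝ (Euc d)}
    (hW : Module.finrank ℝ W = 2) {ω : Fin n → Euc d} (hω : IsGeneric W ω) {w₁ w₂ : Euc d}
    (hspan : ∀ z ∈ W, z = ⟪w₁, z⟫ • w₁ + ⟪w₂, z⟫ • w₂) :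
    edgeCount (convexHull ℝ (Set.range ω) ∩ ↑W) ≤
      facetCount W w₁ w₂ ω + facetCount W (-w₁) w₂ ω +
        (facetCount W w₂ w₁ ω + facetCount W (-w₂) w₁ ω) := by
  let G : Euc d → Euc d → Set (Finset (Fin n)) :=
    fun w w' => {I | I.card = d ∧ ω ∈ gapSet W w w' I 0}
  let φ : Finset (Fin n) → Set (Euc d) :=
    fun J => {z | ∃ b, IsSectionPoint W J ω b ∧ ∑ i, b i • ω i = z}
  have hsub : {F : Set (Euc d) | IsExposed ℝ (convexHull ℝ (Set.range ω) ∩ ↑W) F ∧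
      Module.finrank ℝ (vectorSpan ℝ F) = 1} ⊆
      φ '' ((G w₁ w₂ ∪ G (-w₁) w₂) ∪ (G w₂ w₁ ∪ G (-w₂) w₁)) := by
    rintro F ⟨hF, hF1⟩
    obtain ⟨J, hJ, hFJ, ⟨b, hb⟩, f, β, hfJ, hfle, z, hz, hfz⟩ := hω.exists_facet hW hF hF1
    refine ⟨J, ?_, hFJ.symm⟩
    have hne : ⟪f, w₁⟫ ≠ 0 ∨ ⟪f, w₂⟫ ≠ 0 := by
      by_contra! h
      apply hfz
      rw [hspan z hz, inner_add_right, inner_smul_right, inner_smul_right, h.1, h.2]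
      simp
    rcases le_total |⟪f, w₂⟫| |⟪f, w₁⟫| with h | h
    · left
      have h0 : ⟪f, w₁⟫ ≠ 0 := by
        intro h1
        rw [h1, abs_zero, abs_nonpos_iff] at h
        tauto
      rcases lt_or_gt_of_ne h0 with h1 | h1
      · right
        rw [abs_of_neg h1] at h
        exact ⟨hJ, mem_gapSet_of_support hb hfJ hfle (by rw [inner_neg_right]; linarith)
          (by rwa [inner_neg_right])⟩
      · left
        rw [abs_of_pos h1] at h
        exact ⟨hJ, mem_gapSet_of_support hb hfJ hfle h1 h⟩
    · right
      have h0 : ⟪f, w₂⟫ ≠ 0 := by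
        intro h1
        rw [h1, abs_zero, abs_nonpos_iff] at h
        tauto
      rcases lt_or_gt_of_ne h0 with h1 | h1
      · right
        rw [abs_of_neg h1] at h
        exact ⟨hJ, mem_gapSet_of_support hb hfJ hfle (by rw [inner_neg_right]; linarith)
          (by rwa [inner_neg_right])⟩
      · left
        rw [abs_of_pos h1] at h
        exact ⟨hJ, mem_gapSet_of_support hb hfJ hfle h1 h⟩
  calc edgeCount (convexHull ℝ (Set.range ω) ∩ ↑W)
      ≤ (φ '' ((G w₁ w₂ ∪ G (-w₁) w₂) ∪ (G w₂ w₁ ∪ G (-w₂) w₁))).ncard :=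
        Set.ncard_le_ncard hsub (Set.toFinite _)
    _ ≤ ((G w₁ w₂ ∪ G (-w₁) w₂) ∪ (G w₂ w₁ ∪ G (-w₂) w₁)).ncard :=
        Set.ncard_image_le (Set.toFinite _)
    _ ≤ _ := (Set.ncard_union_le _ _).trans
        (add_le_add (Set.ncard_union_le _ _) (Set.ncard_union_le _ _))

theorem measurableSet_goodSet {n d : ℕ} (W : Submodule ℝ (Euc d)) (w w' : Euc d)
    (I : Finset (Fin n)) (δ η : ℝ) : MeasurableSet (goodSet W w w' I δ η) :=
  (measurableSet_gapSet W w w' I δ).diff <| Finset.measurableSet_biUnion _ fun p _ =>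
    Finset.measurableSet_biUnion _ fun q _ => (isClosed_coordSet W I p q 0 η).measurableSet

theorem pow_mul_measureReal_compl_nearSet_le {n d : ℕ} (m : Fin n → Euc d) {σ ρ : ℝ}
    [hσ : Fact (0 < σ)] (hn : 2 ≤ n) (hd : 1 ≤ d) (hρ : 0 ≤ ρ)
    (hρσ : ρ ^ 2 = 64 * σ ^ 2 * d ^ 2 * Real.log n) :
    (n : ℝ) ^ d * (jointGaussian n d m σ).real (nearSet m ρ)ᶜ ≤ 1 := by
  have hn' : (2 : ℝ) ≤ n := by exact_mod_cast hn
  have hσ0 : σ ≠ 0 := hσ.out.ne'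
  have h1 : (jointGaussian n d m σ).real (nearSet m ρ)ᶜ ≤
      ∑ j : Fin n, (jointGaussian n d m σ).real {ω | ρ < ‖ω j - m j‖} := by
    refine le_trans (measureReal_mono ?_) (measureReal_iUnion_fintype_le _)
    intro ω hω
    simpa [nearSet] using hω
  have hexp : Real.exp (-ρ ^ 2 / (4 * σ ^ 2)) = ((n : ℝ) ^ (16 * d ^ 2))⁻¹ := by
    rw [hρσ, show -(64 * σ ^ 2 * (d : ℝ) ^ 2 * Real.log n) / (4 * σ ^ 2) =
      -(((16 * d ^ 2 : ℕ) : ℝ) * Real.log n) by push_cast; field_simp; ring, Real.exp_neg,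
      Real.exp_nat_mul, Real.exp_log (by linarith)]
  have h2 : ∀ j : Fin n, (jointGaussian n d m σ).real {ω | ρ < ‖ω j - m j‖} ≤
      ((n : ℝ) ^ (16 * d ^ 2))⁻¹ * (n : ℝ) ^ d := by
    intro j
    refine (ENNReal.toReal_mono ENNReal.ofReal_ne_top
      (jointGaussian_lt_norm_le m hσ.out hρ j)).trans ?_
    rw [ENNReal.toReal_ofReal (by positivity), hexp]
    gcongr
    rw [Real.sqrt_le_left (by positivity)]
    nlinarith
  have h3 : (jointGaussian n d m σ).real (nearSet m ρ)ᶜ ≤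
      n * (((n : ℝ) ^ (16 * d ^ 2))⁻¹ * (n : ℝ) ^ d) := by
    refine h1.trans ((Finset.sum_le_sum fun j _ => h2 j).trans_eq ?_)
    simp
  calc (n : ℝ) ^ d * (jointGaussian n d m σ).real (nearSet m ρ)ᶜ
      ≤ (n : ℝ) ^ d * (n * (((n : ℝ) ^ (16 * d ^ 2))⁻¹ * (n : ℝ) ^ d)) := by gcongr
    _ = (n : ℝ) ^ (d + 1 + d) / (n : ℝ) ^ (16 * d ^ 2) := by
        rw [div_eq_mul_inv]
        ring
    _ ≤ 1 := div_le_one_of_le₀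
        (pow_le_pow_right₀ (by linarith) (by nlinarith)) (by positivity)

/-- Most of the mass of a facet event comes from well separated configurations. -/
theorem measureReal_gapSet_le {n d : ℕ} {m : Fin n → Euc d} {σ ρ δ η : ℝ} [Fact (0 < σ)]
    (hm : ∀ i, ‖m i‖ ≤ 1) (hρ0 : 0 ≤ ρ) (hρ1 : ρ ≤ 1) {W : Submodule ℝ (Euc d)}
    (hW : Module.finrank ℝ W = 2) {w w' : Euc d} (hw : w ∈ W) (hw1 : ‖w‖ = 1)
    {I : Finset (Fin n)} (hI : I.card = d) (hδ : 0 ≤ δ) (hη : 0 < η)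
    (hκ : d * ((2 * ρ * δ + δ ^ 2) / (2 * σ ^ 2)) ≤ 1 / 4) {N : ℕ} (hNd : 16 * d ^ 2 ≤ N)
    (hN : 2 * N * η ≤ 1 / 2)
    (hNσ : d * ((2 * ρ * (16 * N * η) + (16 * N * η) ^ 2) / (2 * σ ^ 2)) ≤ 1 / 2) :
    (jointGaussian n d m σ).real (gapSet W w w' I 0) ≤
      2 * (jointGaussian n d m σ).real (goodSet W w w' I δ η ∩ nearSet m ρ) +
        4 * (jointGaussian n d m σ).real (nearSet m ρ)ᶜ := by
  classical
  set μ := jointGaussian n d m σ with hμ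
  set A := gapSet W w w' I 0 with hA
  have hd : 0 < d := by
    have h1 := W.finrank_le
    rw [hW, finrank_euclideanSpace, Fintype.card_fin] at h1
    omega
  have hsplit : ∀ s, μ.real s ≤ μ.real (s ∩ nearSet m ρ) + μ.real (nearSet m ρ)ᶜ := fun s => by
    refine le_trans (measureReal_mono ?_) (measureReal_union_le _ _)
    intro ω hω
    by_cases h : ω ∈ nearSet m ρ
    · exact Or.inl ⟨hω, h⟩
    · exact Or.inr h
  have hshift : 3 / 4 * μ.real (A ∩ nearSet m ρ) ≤ μ.real (gapSet W w w' I δ) := by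
    have h1 := ENNReal.toReal_mono (measure_ne_top _ _)
      (exp_mul_jointGaussian_gapSet_le (m := m) (σ := σ) (ρ := ρ) (w' := w') hδ hw hw1 I)
    rw [ENNReal.toReal_mul, ENNReal.toReal_ofReal (Real.exp_nonneg _), hI] at h1
    refine le_trans ?_ h1
    refine mul_le_mul_of_nonneg_right ?_ ENNReal.toReal_nonneg
    linarith [Real.add_one_le_exp (-(d * ((2 * ρ * δ + δ ^ 2) / (2 * σ ^ 2))))]
  let B : Fin n → Fin n → Set (Fin n → Euc d) := fun p q =>
    (A ∩ coordSet W I p q 0 η) ∩ nearSet m ρ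
  have hB : ∀ p ∈ I, ∀ q ∈ I.erase p, μ.real (B p q) ≤ 1 / (8 * d ^ 2) * μ.real A := by
    intro p hp q hq
    have h1 := ENNReal.toReal_mono (ENNReal.mul_ne_top (by simp) (measure_ne_top _ _))
      (natCast_mul_jointGaussian_coordSet_le (m := m) (σ := σ) (w := w) (w' := w') hm hρ0 hρ1 hW hI
        hp (Finset.mem_of_mem_erase hq) (Finset.ne_of_mem_erase hq).symm hη N hN hNσ)
    rw [ENNReal.toReal_mul, ENNReal.toReal_mul, ENNReal.toReal_natCast, ENNReal.toReal_ofNat] at h1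
    change (N : ℝ) * μ.real (B p q) ≤ 2 * μ.real A at h1
    have h2 : (16 : ℝ) * d ^ 2 ≤ N := by exact_mod_cast hNd
    have h3 := mul_le_mul_of_nonneg_right h2 (measureReal_nonneg (μ := μ) (s := B p q))
    have hd' : (0 : ℝ) < d := by exact_mod_cast hd
    rw [one_div_mul_eq_div, le_div_iff₀ (by positivity)]
    linarith
  have hsum : ∑ p ∈ I, ∑ q ∈ I.erase p, μ.real (B p q) ≤ 1 / 8 * μ.real A := by
    have h1 : ∀ p ∈ I, ∑ q ∈ I.erase p, μ.real (B p q) ≤ d * (1 / (8 * d ^ 2) * μ.real A) := by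
      intro p hp
      refine (Finset.sum_le_card_nsmul _ _ _ (hB p hp)).trans ?_
      rw [nsmul_eq_mul]
      gcongr
      exact (Finset.card_erase_le).trans hI.le
    refine (Finset.sum_le_card_nsmul _ _ _ h1).trans_eq ?_
    have hd' : (d : ℝ) ≠ 0 := by exact_mod_cast hd.ne'
    rw [nsmul_eq_mul, hI]
    field_simp
  have hcover : μ.real (gapSet W w w' I δ ∩ nearSet m ρ) ≤
      μ.real (goodSet W w w' I δ η ∩ nearSet m ρ) +
        ∑ p ∈ I, ∑ q ∈ I.erase p, μ.real (B p q) := by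
    have h1 : gapSet W w w' I δ ∩ nearSet m ρ ⊆
        (goodSet W w w' I δ η ∩ nearSet m ρ) ∪ ⋃ p ∈ I, ⋃ q ∈ I.erase p, B p q := by
      rintro ω ⟨hω, hωρ⟩
      by_cases h : ω ∈ ⋃ p ∈ I, ⋃ q ∈ I.erase p, coordSet W I p q 0 η
      · right
        simp only [mem_iUnion] at h ⊢
        obtain ⟨p, hp, q, hq, h⟩ := h
        exact ⟨p, hp, q, hq, ⟨gapSet_anti W w w' I hδ hω, h⟩, hωρ⟩
      · exact Or.inl ⟨⟨hω, h⟩, hωρ⟩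
    refine (measureReal_mono h1).trans ((measureReal_union_le _ _).trans ?_)
    gcongr
    refine (measureReal_biUnion_finset_le _ _).trans ?_
    gcongr
    exact measureReal_biUnion_finset_le _ _
  have hε : 0 ≤ μ.real (nearSet m ρ)ᶜ := measureReal_nonneg
  have hg : 0 ≤ μ.real (goodSet W w w' I δ η ∩ nearSet m ρ) := measureReal_nonneg
  linarith [hsplit A, hsplit (gapSet W w w' I δ)]

theorem facetCount_eq_sum_indicator {n d : ℕ} (W : Submodule ℝ (Euc d)) (w w' : Euc d)
    (ω : Fin n → Euc d) :
    (facetCount W w w' ω : ℝ≥0∞) =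
      ∑ I ∈ Finset.univ.powersetCard d, (gapSet W w w' I 0).indicator 1 ω := by
  classical
  have h : {I : Finset (Fin n) | I.card = d ∧ ω ∈ gapSet W w w' I 0} =
      ((Finset.univ.powersetCard d).filter fun I => ω ∈ gapSet W w w' I 0 : Finset _) := by
    ext I
    simp
  rw [facetCount, h, Set.ncard_coe_finset, Finset.card_filter]
  push_cast
  refine Finset.sum_congr rfl fun I _ => ?_
  simp [Set.indicator_apply]

theorem sum_measure_goodSet_le {n d : ℕ} {m : Fin n → Euc d} {σ ρ δ η : ℝ} [Fact (0 < σ)]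
    (hm : ∀ i, ‖m i‖ ≤ 1) (hρ1 : ρ ≤ 1) {W : Submodule ℝ (Euc d)}
    (hW : Module.finrank ℝ W = 2) {w w' : Euc d} (hw' : ‖w'‖ = 1)
    (hspan : ∀ z ∈ W, z = ⟪w, z⟫ • w + ⟪w', z⟫ • w') (hδ : 0 < δ) (hη : 0 < η) :
    ∑ I ∈ Finset.univ.powersetCard d,
      jointGaussian n d m σ (goodSet W w w' I δ η ∩ nearSet m ρ) ≤
        ENNReal.ofReal (1 + 3 / Real.sqrt (η * δ)) := by
  classical
  have hmeas : ∀ I : Finset (Fin n), MeasurableSet (goodSet W w w' I δ η ∩ nearSet m ρ) := fun I =>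
    (measurableSet_goodSet W w w' I δ η).inter (measurableSet_nearSet m ρ)
  calc ∑ I ∈ Finset.univ.powersetCard d,
        jointGaussian n d m σ (goodSet W w w' I δ η ∩ nearSet m ρ)
      = ∫⁻ ω, ∑ I ∈ Finset.univ.powersetCard d,
          (goodSet W w w' I δ η ∩ nearSet m ρ).indicator 1 ω ∂(jointGaussian n d m σ) := by
        rw [lintegral_finsetSum _ fun I _ => measurable_one.indicator (hmeas I)]
        exact Finset.sum_congr rfl fun I _ => (lintegral_indicator_one (hmeas I)).symm
    _ ≤ ∫⁻ _, ENNReal.ofReal (1 + 3 / Real.sqrt (η * δ)) ∂(jointGaussian n d m σ) := by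
        refine lintegral_mono fun ω => ?_
        by_cases hω : ω ∈ nearSet m ρ
        · have hω2 : ∀ i, ‖ω i‖ ≤ 2 := fun i => by
            have h1 := norm_sub_norm_le (ω i) (m i)
            linarith [hω i, hm i]
          have h2 := card_goodSet_le hW hw' hspan hω2 hδ hη
            ((Finset.univ.powersetCard d).filter fun I => ω ∈ goodSet W w w' I δ η)
            fun I hI => by simpa using hI
          refine le_trans (le_of_eq ?_) (ENNReal.ofReal_le_ofReal h2)
          rw [ENNReal.ofReal_natCast, Finset.card_filter]
          push_cast
          refine Finset.sum_congr rfl fun I _ => ?_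
          simp [Set.indicator_apply, hω]
        · simp [hω]
    _ = ENNReal.ofReal (1 + 3 / Real.sqrt (η * δ)) := by simp

theorem lintegral_facetCount_le {n d : ℕ} {m : Fin n → Euc d} {σ : ℝ} (hd : 3 ≤ d) (hdn : d ≤ n)
    (hm : ∀ i, ‖m i‖ ≤ 1) (hσ : 0 < σ) (hσ1 : σ ≤ 1 / (8 * d * Real.sqrt (Real.log n)))
    {W : Submodule ℝ (Euc d)} (hW : Module.finrank ℝ W = 2) {w w' : Euc d} (hw : w ∈ W)
    (hw1 : ‖w‖ = 1) (hw' : ‖w'‖ = 1) (hspan : ∀ z ∈ W, z = ⟪w, z⟫ • w + ⟪w', z⟫ • w') :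
    ∫⁻ ω, (facetCount W w w' ω : ℝ≥0∞) ∂(jointGaussian n d m σ) ≤
      ENNReal.ofReal (6150 * (d ^ 3 * Real.sqrt (Real.log n) / σ)) := by
  have : Fact (0 < σ) := ⟨hσ⟩
  set μ := jointGaussian n d m σ with hμ
  have hn3 : (3 : ℝ) ≤ n := by exact_mod_cast hd.trans hdn
  have hd3 : (3 : ℝ) ≤ d := by exact_mod_cast hd
  have hlog : 1 ≤ Real.log n := by
    rw [Real.le_log_iff_exp_le (by linarith)]
    linarith [Real.exp_one_lt_d9]
  set s := Real.sqrt (Real.log n) with hs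
  have hs1 : 1 ≤ s := Real.one_le_sqrt.2 hlog
  have hs2 : s ^ 2 = Real.log n := Real.sq_sqrt (by linarith)
  have hσs : 8 * σ * d * s ≤ 1 := by
    rw [le_div_iff₀ (by positivity)] at hσ1
    linarith
  set ρ := 8 * σ * d * s with hρ
  set δ := σ / (128 * d ^ 2 * s) with hδ
  set η := σ / (8192 * d ^ 4 * s) with hη
  have hρ0 : 0 ≤ ρ := by positivity
  have hδ0 : 0 < δ := by positivity
  have hη0 : 0 < η := by positivity
  have hds : 1 ≤ (d : ℝ) ^ 3 * s ^ 2 := one_le_mul_of_one_le_of_one_le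
    (one_le_pow₀ (by linarith)) (one_le_pow₀ hs1)
  have hκ : d * ((2 * ρ * δ + δ ^ 2) / (2 * σ ^ 2)) ≤ 1 / 4 := by
    have : d * ((2 * ρ * δ + δ ^ 2) / (2 * σ ^ 2)) =
        1 / 16 + 1 / (32768 * (d ^ 3 * s ^ 2)) := by
      rw [hρ, hδ]
      field_simp
      ring
    rw [this]
    have h2 : 1 / (32768 * ((d : ℝ) ^ 3 * s ^ 2)) ≤ 1 / 32768 :=
      one_div_le_one_div_of_le (by norm_num) (by linarith)
    linarith
  have hx : 16 * ((16 * d ^ 2 : ℕ) : ℝ) * η = σ / (32 * d ^ 2 * s) := by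
    rw [hη]
    push_cast
    field_simp
    ring
  have hσ1' : σ ≤ 1 := by
    have : 1 ≤ (d : ℝ) * s := one_le_mul_of_one_le_of_one_le (by linarith) hs1
    nlinarith
  have hN : 2 * ((16 * d ^ 2 : ℕ) : ℝ) * η ≤ 1 / 2 := by
    have h1 : σ / (32 * d ^ 2 * s) ≤ 1 := by
      rw [div_le_one (by positivity)]
      have : 1 ≤ (d : ℝ) ^ 2 * s :=
        one_le_mul_of_one_le_of_one_le (one_le_pow₀ (by linarith)) hs1
      linarith
    linarith
  have hNσ : d * ((2 * ρ * (16 * ((16 * d ^ 2 : ℕ) : ℝ) * η) +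
      (16 * ((16 * d ^ 2 : ℕ) : ℝ) * η) ^ 2) / (2 * σ ^ 2)) ≤ 1 / 2 := by
    rw [hx]
    have : d * ((2 * ρ * (σ / (32 * d ^ 2 * s)) + (σ / (32 * d ^ 2 * s)) ^ 2) / (2 * σ ^ 2)) =
        1 / 4 + 1 / (2048 * (d ^ 3 * s ^ 2)) := by
      rw [hρ]
      field_simp
      ring
    rw [this]
    have h2 : 1 / (2048 * ((d : ℝ) ^ 3 * s ^ 2)) ≤ 1 / 2048 :=
      one_div_le_one_div_of_le (by norm_num) (by linarith)
    linarith
  have hsqrt : Real.sqrt (η * δ) = σ / (1024 * d ^ 3 * s) := by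
    rw [show η * δ = (σ / (1024 * d ^ 3 * s)) ^ 2 by rw [hη, hδ]; field_simp; ring]
    exact Real.sqrt_sq (by positivity)
  have hfar : (n : ℝ) ^ d * μ.real (nearSet m ρ)ᶜ ≤ 1 :=
    pow_mul_measureReal_compl_nearSet_le m (by omega) (by omega) hρ0
      (by rw [hρ, ← hs2]; ring)
  have hgood : ∑ I ∈ Finset.univ.powersetCard d,
      μ.real (goodSet W w w' I δ η ∩ nearSet m ρ) ≤ 1 + 3 / Real.sqrt (η * δ) := by
    have h1 := ENNReal.toReal_mono ENNReal.ofReal_ne_top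
      (sum_measure_goodSet_le (m := m) (σ := σ) hm hσs hW hw' hspan hδ0 hη0)
    rwa [ENNReal.toReal_sum fun I _ => measure_ne_top _ _,
      ENNReal.toReal_ofReal (by positivity)] at h1
  have hcard : (((Finset.univ : Finset (Fin n)).powersetCard d).card : ℝ) ≤ (n : ℝ) ^ d := by
    rw [Finset.card_powersetCard, Finset.card_fin]
    exact_mod_cast Nat.choose_le_pow n d
  have hone : 1 ≤ (d : ℝ) ^ 3 * s / σ := by
    rw [one_le_div hσ]
    exact hσ1'.trans (one_le_mul_of_one_le_of_one_le (one_le_pow₀ (by linarith)) hs1)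
  have hmain : ∑ I ∈ Finset.univ.powersetCard d, μ.real (gapSet W w w' I 0) ≤
      6150 * (d ^ 3 * s / σ) := by
    calc ∑ I ∈ Finset.univ.powersetCard d, μ.real (gapSet W w w' I 0)
        ≤ ∑ I ∈ Finset.univ.powersetCard d,
          (2 * μ.real (goodSet W w w' I δ η ∩ nearSet m ρ) + 4 * μ.real (nearSet m ρ)ᶜ) :=
          Finset.sum_le_sum fun I hI => measureReal_gapSet_le hm hρ0 hσs hW hw hw1
            (Finset.mem_powersetCard.1 hI).2 hδ0.le hη0 hκ le_rfl hN hNσ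
      _ = 2 * ∑ I ∈ Finset.univ.powersetCard d, μ.real (goodSet W w w' I δ η ∩ nearSet m ρ) +
          4 * (((Finset.univ : Finset (Fin n)).powersetCard d).card * μ.real (nearSet m ρ)ᶜ) := by
          rw [Finset.sum_add_distrib, ← Finset.mul_sum, Finset.sum_const, nsmul_eq_mul]
          ring
      _ ≤ 2 * (1 + 3 / Real.sqrt (η * δ)) + 4 * 1 := by
          gcongr
          exact (mul_le_mul_of_nonneg_right hcard measureReal_nonneg).trans hfar
      _ ≤ 6150 * (d ^ 3 * s / σ) := by
          rw [hsqrt, show 3 / (σ / (1024 * d ^ 3 * s)) = 3072 * (d ^ 3 * s / σ) by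
            field_simp; ring]
          linarith
  calc ∫⁻ ω, (facetCount W w w' ω : ℝ≥0∞) ∂μ
      = ∑ I ∈ Finset.univ.powersetCard d, μ (gapSet W w w' I 0) := by
        simp_rw [facetCount_eq_sum_indicator]
        rw [lintegral_finsetSum _ fun I _ =>
          measurable_one.indicator (measurableSet_gapSet W w w' I 0)]
        exact Finset.sum_congr rfl fun I _ =>
          lintegral_indicator_one (measurableSet_gapSet W w w' I 0)
    _ = ENNReal.ofReal (∑ I ∈ Finset.univ.powersetCard d, μ.real (gapSet W w w' I 0)) := by
        rw [ENNReal.ofReal_sum_of_nonneg fun I _ => measureReal_nonneg]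
        exact Finset.sum_congr rfl fun I _ => (ofReal_measureReal (measure_ne_top _ _)).symm
    _ ≤ _ := ENNReal.ofReal_le_ofReal hmain

theorem measurable_facetCount {n d : ℕ} (W : Submodule ℝ (Euc d)) (w w' : Euc d) :
    Measurable fun ω : Fin n → Euc d => (facetCount W w w' ω : ℝ≥0∞) := by
  simp_rw [facetCount_eq_sum_indicator]
  exact Finset.measurable_fun_sum _ fun I _ =>
    measurable_one.indicator (measurableSet_gapSet W w w' I 0)

theorem exists_orthonormal_span {d : ℕ} {W : Submodule ℝ (Euc d)}
    (hW : Module.finrank ℝ W = 2) :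
    ∃ w₁ ∈ W, ∃ w₂ ∈ W, ‖w₁‖ = 1 ∧ ‖w₂‖ = 1 ∧
      ∀ z ∈ W, z = ⟪w₁, z⟫ • w₁ + ⟪w₂, z⟫ • w₂ := by
  let e := (stdOrthonormalBasis ℝ W).reindex (finCongr hW)
  refine ⟨e 0, (e 0).2, e 1, (e 1).2, e.orthonormal.1 0, e.orthonormal.1 1, fun z hz => ?_⟩
  have h := e.sum_repr' ⟨z, hz⟩
  rw [Fin.sum_univ_two] at h
  exact (congrArg Subtype.val h).symm

theorem cube_mul_sqrt_div_le {d L σ : ℝ} (hd : 1 ≤ d) (hL : 1 ≤ L) (hσ : 0 < σ) (hσ1 : σ ≤ 1) :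
    d ^ 3 * Real.sqrt L / σ ≤ σ ^ (-(3 : ℝ) / 2) * d ^ ((13 : ℝ) / 4) * L ^ ((5 : ℝ) / 4) := by
  have h1 : d ^ 3 ≤ d ^ ((13 : ℝ) / 4) := by
    rw [← Real.rpow_natCast]
    exact Real.rpow_le_rpow_of_exponent_le hd (by norm_num)
  have h2 : Real.sqrt L ≤ L ^ ((5 : ℝ) / 4) := by
    rw [Real.sqrt_eq_rpow]
    exact Real.rpow_le_rpow_of_exponent_le hL (by norm_num)
  have h3 : σ⁻¹ ≤ σ ^ (-(3 : ℝ) / 2) := by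
    rw [← Real.rpow_neg_one]
    exact Real.rpow_le_rpow_of_exponent_ge hσ hσ1 (by norm_num)
  calc d ^ 3 * Real.sqrt L / σ = σ⁻¹ * d ^ 3 * Real.sqrt L := by rw [div_eq_mul_inv]; ring
    _ ≤ _ := by gcongr

/-- Theorem: multi-dimensional smoothed shadow bound.
For `n ≥ d ≥ 3`, any two-dimensional linear subspace `W ⊆ ℝ^d`, any means `ā_i` of norm at
most one, and any `0 < σ ≤ 1/(8 d √(log n))`, if `a_1,…,a_n` are independent with
`a_i ∼ N(ā_i, σ² I_d)`, then
`E[edges(conv(a_1,…,a_n) ∩ W)] ≤ C σ^(-3/2) d^(13/4) (log n)^(5/4)` for a universal `C > 0`. -/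
theorem stmt_0 :
    ∃ C : ℝ, 0 < C ∧
      ∀ (n d : ℕ), 3 ≤ d → d ≤ n →
      ∀ (W : Submodule ℝ (Euc d)), Module.finrank ℝ W = 2 →
      ∀ (abar : Fin n → Euc d), (∀ i, ‖abar i‖ ≤ 1) →
      ∀ (σ : ℝ), 0 < σ → σ ≤ 1 / (8 * d * Real.sqrt (Real.log n)) →
      ∫⁻ ω, (edgeCount (convexHull ℝ (Set.range ω) ∩ ↑W) : ℝ≥0∞)
          ∂(jointGaussian n d abar σ)
        ≤ ENNReal.ofReal
            (C * σ ^ (-(3:ℝ)/2) * (d : ℝ) ^ ((13:ℝ)/4) * Real.log n ^ ((5:ℝ)/4)) := by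
  refine ⟨24600, by norm_num, fun n d hd hdn W hW m hm σ hσ hσ1 => ?_⟩
  obtain ⟨w₁, hw₁, w₂, hw₂, hn₁, hn₂, hspan⟩ := exists_orthonormal_span hW
  set X := (d : ℝ) ^ 3 * Real.sqrt (Real.log n) / σ with hX
  have hX0 : 0 ≤ X := by positivity
  have h₁ : ∫⁻ ω, (facetCount W w₁ w₂ ω : ℝ≥0∞) ∂(jointGaussian n d m σ) ≤
      ENNReal.ofReal (6150 * X) :=
    lintegral_facetCount_le hd hdn hm hσ hσ1 hW hw₁ hn₁ hn₂ hspan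
  have h₂ : ∫⁻ ω, (facetCount W (-w₁) w₂ ω : ℝ≥0∞) ∂(jointGaussian n d m σ) ≤
      ENNReal.ofReal (6150 * X) :=
    lintegral_facetCount_le hd hdn hm hσ hσ1 hW (W.neg_mem hw₁) (by rwa [norm_neg]) hn₂
      fun z hz => by simpa using hspan z hz
  have h₃ : ∫⁻ ω, (facetCount W w₂ w₁ ω : ℝ≥0∞) ∂(jointGaussian n d m σ) ≤
      ENNReal.ofReal (6150 * X) :=
    lintegral_facetCount_le hd hdn hm hσ hσ1 hW hw₂ hn₂ hn₁
      fun z hz => (hspan z hz).trans (add_comm _ _)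
  have h₄ : ∫⁻ ω, (facetCount W (-w₂) w₁ ω : ℝ≥0∞) ∂(jointGaussian n d m σ) ≤
      ENNReal.ofReal (6150 * X) :=
    lintegral_facetCount_le hd hdn hm hσ hσ1 hW (W.neg_mem hw₂) (by rwa [norm_neg]) hn₁
      fun z hz => by simpa using (hspan z hz).trans (add_comm _ _)
  have hn3 : (3 : ℝ) ≤ n := by exact_mod_cast hd.trans hdn
  have hd3 : (3 : ℝ) ≤ d := by exact_mod_cast hd
  have hlog : 1 ≤ Real.log n := by
    rw [Real.le_log_iff_exp_le (by linarith)]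
    linarith [Real.exp_one_lt_d9]
  have hσ1' : σ ≤ 1 := by
    refine hσ1.trans (div_le_one_of_le₀ ?_ (by positivity))
    exact one_le_mul_of_one_le_of_one_le (by linarith) (Real.one_le_sqrt.2 hlog)
  calc ∫⁻ ω, (edgeCount (convexHull ℝ (Set.range ω) ∩ ↑W) : ℝ≥0∞) ∂(jointGaussian n d m σ)
      ≤ ∫⁻ ω, (((facetCount W w₁ w₂ ω : ℝ≥0∞) + facetCount W (-w₁) w₂ ω) +
          ((facetCount W w₂ w₁ ω : ℝ≥0∞) + facetCount W (-w₂) w₁ ω))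
          ∂(jointGaussian n d m σ) := by
        refine lintegral_mono_ae ?_
        filter_upwards [ae_isGeneric m σ hW] with ω hω
        exact_mod_cast hω.edgeCount_le hW hspan
    _ ≤ (ENNReal.ofReal (6150 * X) + ENNReal.ofReal (6150 * X)) +
          (ENNReal.ofReal (6150 * X) + ENNReal.ofReal (6150 * X)) := by
        rw [lintegral_add_left (by
            exact (measurable_facetCount W w₁ w₂).add (measurable_facetCount W (-w₁) w₂)),
          lintegral_add_left (measurable_facetCount W w₁ w₂),
          lintegral_add_left (measurable_facetCount W w₂ w₁)]
        exact add_le_add (add_le_add h₁ h₂) (add_le_add h₃ h₄)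
    _ = ENNReal.ofReal (24600 * X) := by
        rw [← ENNReal.ofReal_add (by positivity) (by positivity),
          ← ENNReal.ofReal_add (by positivity) (by positivity)]
        congr 1
        ring
    _ ≤ _ := by
        refine ENNReal.ofReal_le_ofReal ?_
        have := cube_mul_sqrt_div_le (d := d) (by linarith) hlog hσ hσ1'
        rw [mul_assoc, mul_assoc, ← mul_assoc (σ ^ _)]
        linarith
end
end

section
/- Let a₁,…,a_n ∈ ℝ² be n independent random vectors, each with an L-log-Lipschitz probability density. For any I = {i, i′} ∈ ([n] choose 2), conditional on the edge event E_I, let y be the outer unit normal of the edge conv(a_i, a_{i′}) of the polygon conv(a₁,…,a_n). Then for each i ∈ I, Pr[ yᵀa_i − max_{j ∉ I} yᵀa_j ≥ 1/L | E_I ] ≥ 0.1. -/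
open MeasureTheory Set
open scoped ENNReal ProbabilityTheory Pointwise RealInnerProductSpace

noncomputable section

/-- A probability density is `L`-log-Lipschitz. -/
def IsLogLipschitz {E : Type*} [NormedAddCommGroup E] (L : ℝ) (f : E → ℝ) : Prop :=
  (∀ x, 0 < f x) ∧ ∀ x y, f x ≤ Real.exp (L * ‖x - y‖) * f y

/-- `F` is a facet ((d-1)-dimensional exposed proper face) of `Q ⊆ ℝ^d`. -/
def IsFacet {d : ℕ} (Q F : Set (Euc d)) : Prop :=
  IsExposed ℝ Q F ∧ F ≠ Q ∧ Module.finrank ℝ (vectorSpan ℝ F) + 1 = d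

/-- `R` is a ridge ((d-2)-dimensional exposed face) of `Q ⊆ ℝ^d`. -/
def IsRidge {d : ℕ} (Q R : Set (Euc d)) : Prop :=
  IsExposed ℝ Q R ∧ Module.finrank ℝ (vectorSpan ℝ R) + 2 = d

/-- The edge event `E_I`: `conv(a_i : i ∈ I)` is a facet of `conv(a_1,…,a_n)` and it meets `W`. -/
def edgeEvent {n d : ℕ} (W : Submodule ℝ (Euc d)) (I : Finset (Fin n)) :
    Set (Fin n → Euc d) :=
  {ω | IsFacet (convexHull ℝ (Set.range ω)) (convexHull ℝ (ω '' ↑I)) ∧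
    (convexHull ℝ (ω '' ↑I) ∩ ↑W).Nonempty}

/-- The vertex event `A_J`: `conv(a_j : j ∈ J)` is a ridge of `conv(a_1,…,a_n)` meeting `W`. -/
def vertexEvent {n d : ℕ} (W : Submodule ℝ (Euc d)) (J : Finset (Fin n)) :
    Set (Fin n → Euc d) :=
  {ω | IsRidge (convexHull ℝ (Set.range ω)) (convexHull ℝ (ω '' ↑J)) ∧
    (convexHull ℝ (ω '' ↑J) ∩ ↑W).Nonempty}

/-- `y` is an outer unit normal, within the subspace `W`, of the face `e` of `S`:
`y ∈ W` is a unit vector whose inner product with points of `S` is maximized exactly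
at the points of `e`. -/
def IsOuterNormal {d : ℕ} (W : Submodule ℝ (Euc d)) (S e : Set (Euc d)) (y : Euc d) : Prop :=
  y ∈ W ∧ ‖y‖ = 1 ∧ ∀ p ∈ e, ∀ q ∈ S, ⟪y, q⟫ ≤ ⟪y, p⟫

/-- With respect to the orientation form `o` (an alternating bilinear form which is
non-degenerate on the plane of interest), the segment `[p₁, p₂]` is an edge of the planar
convex set `S` and `p₂` is its second endpoint in clockwise order: all of `S` lies on the
non-positive side of the oriented line through `p₁, p₂`.  Consequently, "the next vertex of
`S` after the edge `[p₁,p₂]` in clockwise order" is the point `p₃` with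
`IsClockwiseEdge o S p₂ p₃`. -/
def IsClockwiseEdge {d : ℕ} (o : Euc d →ₗ[ℝ] Euc d →ₗ[ℝ] ℝ) (S : Set (Euc d))
    (p₁ p₂ : Euc d) : Prop :=
  p₁ ≠ p₂ ∧ IsExposed ℝ S (segment ℝ p₁ p₂) ∧ ∀ q ∈ S, o (p₂ - p₁) (q - p₁) ≤ 0

/-- The quarter turn of the plane, scaled by `s`. -/
def perp (s : ℝ) (w : Euc 2) : Euc 2 := !₂[-s * w 1, s * w 0]

lemma inner_perp (s : ℝ) (w x : Euc 2) : ⟪perp s w, x⟫ = s * (w 0 * x 1 - w 1 * x 0) := by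
  simp [perp, PiLp.inner_apply, Fin.sum_univ_two]
  ring

lemma inner_perp_self (s : ℝ) (w : Euc 2) : ⟪perp s w, w⟫ = 0 := by
  rw [inner_perp]; ring

lemma norm_perp {s : ℝ} (hs : s ^ 2 = 1) (w : Euc 2) : ‖perp s w‖ = ‖w‖ := by
  simp only [EuclideanSpace.norm_eq, perp, Fin.sum_univ_two, Real.norm_eq_abs, sq_abs]
  congr 1
  simp
  linear_combination (w 0 ^ 2 + w 1 ^ 2) * hs

lemma measurable_perp (s : ℝ) : Measurable (perp s) := by
  have : Continuous (perp s) := by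
    unfold perp
    fun_prop
  exact this.measurable

/-- A vector of the plane orthogonal to `w ≠ 0` is a multiple of the quarter turn of `w`. -/
lemma exists_eq_smul_perp {w z : Euc 2} (hw : w ≠ 0) (hz : ⟪z, w⟫ = 0) :
    ∃ c : ℝ, z = c • perp 1 w := by
  have hz' : z 0 * w 0 + z 1 * w 1 = 0 := by
    simpa [PiLp.inner_apply, Fin.sum_univ_two, mul_comm] using hz
  have hN : w 0 ^ 2 + w 1 ^ 2 ≠ 0 := by
    intro h
    apply hw
    ext k
    fin_cases k
    · simpa using (by nlinarith [sq_nonneg (w 0), sq_nonneg (w 1)] : w 0 ^ 2 = 0)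
    · simpa using (by nlinarith [sq_nonneg (w 0), sq_nonneg (w 1)] : w 1 ^ 2 = 0)
  refine ⟨(w 0 * z 1 - w 1 * z 0) / (w 0 ^ 2 + w 1 ^ 2), ?_⟩
  ext k
  fin_cases k
  · simp [perp]
    field_simp
    linear_combination w 0 * hz'
  · simp [perp]
    field_simp
    linear_combination w 1 * hz'

/-- Translating one coordinate by a function of another one preserves volume. -/
lemma measurePreserving_update_add {n : ℕ} {k m : Fin n} (hkm : m ≠ k) {g : Euc 2 → Euc 2}
    (hg : Measurable g) :
    MeasurePreserving (fun ω : Fin n → Euc 2 => Function.update ω k (ω k + g (ω m))) := by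
  obtain _ | n := n
  · exact k.elim0
  obtain ⟨j, rfl⟩ := Fin.exists_succAbove_eq hkm
  have he := volume_preserving_piFinSuccAbove (fun _ : Fin (n + 1) => Euc 2) k
  have hskew : MeasurePreserving
      (fun p : (Fin n → Euc 2) × Euc 2 => (p.1, p.2 + g (p.1 j)))
      (volume.prod volume) (volume.prod volume) := by
    refine (MeasurePreserving.id _).skew_product
      (g := fun (r : Fin n → Euc 2) (x : Euc 2) => x + g (r j)) ?_ ?_
    · exact measurable_snd.add (hg.comp ((measurable_pi_apply j).comp measurable_fst))
    · exact ae_of_all _ fun r => map_add_right_eq_self _ _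
  have hswap := (Measure.measurePreserving_swap.comp hskew).comp
    (Measure.measurePreserving_swap (μ := (volume : Measure (Euc 2)))
      (ν := (volume : Measure (Fin n → Euc 2))))
  have h := (he.symm.comp hswap).comp he
  convert h using 1
  funext ω
  refine (Equiv.eq_symm_apply _).2 ?_
  ext1
  · simp [MeasurableEquiv.piFinSuccAbove, Fin.insertNthEquiv, Fin.removeNth]
  · funext l
    simp [MeasurableEquiv.piFinSuccAbove, Fin.insertNthEquiv, Fin.removeNth]

/-- Translating two coordinates by the same function of their difference preserves volume. -/
lemma measurePreserving_translate_pair {n : ℕ} {a b : Fin n} (hab : a ≠ b) {v : Euc 2 → Euc 2}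
    (hv : Measurable v) :
    MeasurePreserving (fun (ω : Fin n → Euc 2) (k : Fin n) =>
      if k = a ∨ k = b then ω k + v (ω b - ω a) else ω k) := by
  have h := ((measurePreserving_update_add hab measurable_id).comp
    (measurePreserving_update_add hab.symm hv)).comp
    (measurePreserving_update_add hab measurable_neg)
  convert h using 1
  funext ω k
  by_cases hka : k = a
  · subst hka
    simp [hab, sub_eq_add_neg]
  · by_cases hkb : k = b
    · subst hkb
      simp [hab, hab.symm, sub_eq_add_neg]
    · simp [hka, hkb]

lemma IsLogLipschitz.continuous {E : Type*} [NormedAddCommGroup E] {L : ℝ} {f : E → ℝ}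
    (hf : IsLogLipschitz L f) : Continuous f := by
  refine continuous_iff_continuousAt.2 fun x => ?_
  have hexp : ∀ c : ℝ, Filter.Tendsto (fun y => Real.exp (c * ‖y - x‖) * f x) (nhds x)
      (nhds (f x)) := fun c => by
    have : Continuous fun y => Real.exp (c * ‖y - x‖) * f x := by fun_prop
    simpa using this.tendsto x
  refine tendsto_of_tendsto_of_tendsto_of_le_of_le (hexp (-L)) (hexp L) (fun y => ?_)
    fun y => hf.2 y x
  have h := hf.2 x y
  rw [norm_sub_rev] at h
  calc Real.exp (-L * ‖y - x‖) * f x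
      ≤ Real.exp (-L * ‖y - x‖) * (Real.exp (L * ‖y - x‖) * f y) := by gcongr
    _ = f y := by rw [← mul_assoc, ← Real.exp_add]; simp

lemma measurable_productDensity {n d : ℕ} {L : ℝ} {f : Fin n → Euc d → ℝ}
    (hf : ∀ i, IsLogLipschitz L (f i)) :
    Measurable fun ω : Fin n → Euc d => ENNReal.ofReal (∏ i, f i (ω i)) := by
  have : Continuous fun ω : Fin n → Euc d => ∏ i, f i (ω i) :=
    continuous_finsetProd _ fun i _ => (hf i).continuous.comp (continuous_apply i)
  exact this.measurable.ennreal_ofReal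

lemma productDensityMeasure_ne_top {n d : ℕ} {L : ℝ} {f : Fin n → Euc d → ℝ}
    (hf : ∀ i, IsLogLipschitz L (f i)) (hnorm : ∀ i, ∫⁻ x, ENNReal.ofReal (f i x) = 1)
    (s : Set (Fin n → Euc d)) : productDensityMeasure f s ≠ ∞ := by
  have hint : ∀ i, Integrable (f i) := fun i => by
    refine (lintegral_ofReal_ne_top_iff_integrable (hf i).continuous.aestronglyMeasurable
      (ae_of_all _ fun x => ((hf i).1 x).le)).1 ?_
    simp [hnorm]
  have hprod : Integrable fun ω : Fin n → Euc d => ∏ i, f i (ω i) := Integrable.fintype_prod hint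
  refine ((measure_mono (subset_univ s)).trans_lt ?_).ne
  rw [productDensityMeasure, withDensity_apply _ MeasurableSet.univ, Measure.restrict_univ]
  exact hprod.lintegral_lt_top

/-- The points `ω a`, `ω b` are distinct and every point with index outside `I` lies at signed
distance at least `c` behind the line through them, oriented by the sign `s`. -/
def sideEvent {n : ℕ} (s c : ℝ) (a b : Fin n) (I : Finset (Fin n)) : Set (Fin n → Euc 2) :=
  {ω | ω b - ω a ≠ 0 ∧
    ∀ j ∉ I, ⟪perp s (ω b - ω a), ω j - ω a⟫ ≤ -(c * ‖ω b - ω a‖)}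

lemma measurableSet_sideEvent {n : ℕ} (s c : ℝ) (a b : Fin n) (I : Finset (Fin n)) :
    MeasurableSet (sideEvent s c a b I) := by
  have hsub : ∀ j, Measurable fun ω : Fin n → Euc 2 => ω j - ω a := fun j =>
    (measurable_pi_apply j).sub (measurable_pi_apply a)
  refine MeasurableSet.inter ?_ ?_
  · exact (hsub b) (measurableSet_singleton (0 : Euc 2)).compl
  · have hset : {ω : Fin n → Euc 2 | ∀ j ∉ I,
        ⟪perp s (ω b - ω a), ω j - ω a⟫ ≤ -(c * ‖ω b - ω a‖)} =
        ⋂ j, ⋂ (_ : j ∉ I), {ω | ⟪perp s (ω b - ω a), ω j - ω a⟫ ≤ -(c * ‖ω b - ω a‖)} := by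
      ext ω
      simp
    change MeasurableSet {ω : Fin n → Euc 2 | ∀ j ∉ I, _}
    rw [hset]
    refine MeasurableSet.iInter fun j => MeasurableSet.iInter fun _ => ?_
    exact measurableSet_le (((measurable_perp s).comp (hsub b)).inner (hsub j))
      (((hsub b).norm.const_mul c).neg)

/-- The translation by `1 / L` along the unit vector with direction `perp s w`. -/
def normalShift (s L : ℝ) (w : Euc 2) : Euc 2 := (L * ‖w‖)⁻¹ • perp s w

lemma measurable_normalShift (s L : ℝ) : Measurable (normalShift s L) :=
  (measurable_norm.const_mul L).inv.smul (measurable_perp s)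

lemma norm_normalShift_le {s L : ℝ} (hs : s ^ 2 = 1) (hL : 0 < L) (w : Euc 2) :
    ‖normalShift s L w‖ ≤ 1 / L := by
  rw [normalShift, norm_smul, norm_perp hs, norm_inv, norm_mul, norm_norm,
    Real.norm_of_nonneg hL.le]
  rcases eq_or_ne ‖w‖ 0 with h | h
  · simp [h, hL.le]
  · apply le_of_eq
    field_simp

lemma inner_perp_normalShift {s L : ℝ} (hs : s ^ 2 = 1) {w : Euc 2} (hw : w ≠ 0) :
    ⟪perp s w, normalShift s L w⟫ = 1 / L * ‖w‖ := by
  have hw' : ‖w‖ ≠ 0 := norm_ne_zero_iff.2 hw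
  rw [normalShift, inner_smul_right, real_inner_self_eq_norm_sq, norm_perp hs, mul_inv]
  field_simp

lemma productDensityMeasure_sideEvent_le {n : ℕ} {L s : ℝ} (hL : 0 < L) (hs : s ^ 2 = 1)
    {f : Fin n → Euc 2 → ℝ} (hf : ∀ i, IsLogLipschitz L (f i)) {a b : Fin n} (hab : a ≠ b) :
    productDensityMeasure f (sideEvent s 0 a b {a, b}) ≤
      ENNReal.ofReal (Real.exp 1 ^ 2) *
        productDensityMeasure f (sideEvent s (1 / L) a b {a, b}) := by
  set T := fun (ω : Fin n → Euc 2) (k : Fin n) =>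
    if k = a ∨ k = b then ω k + normalShift s L (ω b - ω a) else ω k with hT
  have hTmp : MeasurePreserving T :=
    measurePreserving_translate_pair hab (measurable_normalShift s L)
  have hmaps : sideEvent s 0 a b {a, b} ⊆ T ⁻¹' sideEvent s (1 / L) a b {a, b} := by
    rintro ω ⟨hne, hside⟩
    have hTab : T ω b - T ω a = ω b - ω a := by simp [hT]
    refine ⟨by rwa [hTab], fun j hj => ?_⟩
    have hTj : T ω j - T ω a = (ω j - ω a) - normalShift s L (ω b - ω a) := by
      have hj' : ¬ (j = a ∨ j = b) := by simpa using hj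
      simp only [hT, if_neg hj', true_or, if_true]
      abel
    rw [hTab, hTj, inner_sub_right, inner_perp_normalShift hs hne]
    have := hside j hj
    linarith
  have hdens : ∀ ω : Fin n → Euc 2,
      ∏ k, f k (ω k) ≤ Real.exp 1 ^ 2 * ∏ k, f k (T ω k) := by
    intro ω
    have hconst : ∏ k, (if k ∈ ({a, b} : Finset (Fin n)) then Real.exp 1 else 1) =
        Real.exp 1 ^ 2 := by
      rw [Finset.prod_ite_mem, Finset.univ_inter, Finset.prod_const, Finset.card_pair hab]
    rw [← hconst, ← Finset.prod_mul_distrib]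
    refine Finset.prod_le_prod (fun k _ => ((hf k).1 _).le) fun k _ => ?_
    by_cases hk : k = a ∨ k = b
    · have hk' : k ∈ ({a, b} : Finset (Fin n)) := by simpa using hk
      rw [if_pos hk']
      refine ((hf k).2 (ω k) (T ω k)).trans ?_
      have hle : L * ‖ω k - T ω k‖ ≤ 1 := by
        simp only [hT, if_pos hk, sub_add_cancel_left, norm_neg]
        calc L * ‖normalShift s L (ω b - ω a)‖ ≤ L * (1 / L) := by
              gcongr; exact norm_normalShift_le hs hL _
          _ = 1 := by field_simp
      have := (hf k).1 (T ω k)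
      gcongr
    · simp [hT, hk]
  have hρ := measurable_productDensity hf
  have hB := measurableSet_sideEvent s (1 / L) a b ({a, b} : Finset (Fin n))
  rw [productDensityMeasure, withDensity_apply _ (measurableSet_sideEvent ..),
    withDensity_apply _ hB, ← hTmp.setLIntegral_comp_preimage hB hρ,
    ← lintegral_const_mul (f := fun ω => ENNReal.ofReal (∏ i, f i (T ω i))) _
      (hρ.comp hTmp.measurable)]
  refine (lintegral_mono_set hmaps).trans (lintegral_mono fun ω => ?_)
  rw [← ENNReal.ofReal_mul (by positivity)]
  exact ENNReal.ofReal_le_ofReal (hdens ω)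

/-- If a linear functional `l` equals `M` on part of a family and is smaller on the rest, it is at
most `M` on the convex hull, with equality only on the convex hull of that part. -/
lemma lt_or_mem_convexHull_image {ι E : Type*} [AddCommGroup E] [Module ℝ E] {ω : ι → E}
    {I : Set ι} {l : E →ₗ[ℝ] ℝ} {M : ℝ} (hI : ∀ i ∈ I, l (ω i) = M)
    (hIc : ∀ j ∉ I, l (ω j) < M) {x : E} (hx : x ∈ convexHull ℝ (range ω)) :
    l x < M ∨ (l x = M ∧ x ∈ convexHull ℝ (ω '' I)) := by
  refine convexHull_min (t := {x | l x < M ∨ (l x = M ∧ x ∈ convexHull ℝ (ω '' I))}) ?_ ?_ hx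
  · rintro _ ⟨j, rfl⟩
    by_cases hj : j ∈ I
    · exact Or.inr ⟨hI j hj, subset_convexHull ℝ _ (mem_image_of_mem ω hj)⟩
    · exact Or.inl (hIc j hj)
  · refine convex_iff_forall_pos.2 fun x hx y hy p q hp hq hpq => ?_
    have hM : M = p * M + q * M := by rw [← add_mul, hpq, one_mul]
    simp only [Set.mem_ofPred_eq, map_add, map_smul, smul_eq_mul] at hx hy ⊢
    rcases hx with hx | ⟨hx, hx'⟩ <;> rcases hy with hy | ⟨hy, hy'⟩
    · left; nlinarith
    · left; nlinarith
    · left; nlinarith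
    · exact Or.inr ⟨by rw [hx, hy, ← hM], convex_convexHull ℝ _ hx' hy' hp.le hq.le hpq⟩

lemma image_pair_eq {n : ℕ} (ω : Fin n → Euc 2) (a b : Fin n) :
    ω '' (({a, b} : Finset (Fin n)) : Set (Fin n)) = {ω a, ω b} := by
  simp [Set.image_pair]

lemma finrank_vectorSpan_convexHull_pair {p q : Euc 2} (h : q - p ≠ 0) :
    Module.finrank ℝ (vectorSpan ℝ (convexHull ℝ {p, q})) = 1 := by
  rw [convexHull_pair, vectorSpan_segment]
  simpa using finrank_span_singleton (K := ℝ) h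

lemma sideEvent_subset_edgeEvent {n : ℕ} {s c : ℝ} (hc : 0 < c) {a b j₀ : Fin n}
    (hj₀ : j₀ ∉ ({a, b} : Finset (Fin n))) :
    sideEvent s c a b {a, b} ⊆ edgeEvent ⊤ {a, b} := by
  rintro ω ⟨hne, hside⟩
  set z := perp s (ω b - ω a)
  have hab : ∀ k ∈ (({a, b} : Finset (Fin n)) : Set (Fin n)),
      innerₛₗ ℝ z (ω k) = ⟪z, ω a⟫ := by
    intro k hk
    have h0 : ⟪z, ω b - ω a⟫ = 0 := inner_perp_self _ _
    rw [inner_sub_right] at h0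
    rcases (by simpa using hk : k = a ∨ k = b) with rfl | rfl
    · simp
    · simp only [innerₛₗ_apply_apply]; linarith
  have hlt : ∀ j ∉ (({a, b} : Finset (Fin n)) : Set (Fin n)),
      innerₛₗ ℝ z (ω j) < ⟪z, ω a⟫ := by
    intro j hj
    have h := hside j (by simpa using hj)
    rw [inner_sub_right] at h
    have : 0 < c * ‖ω b - ω a‖ := mul_pos hc (norm_pos_iff.2 hne)
    simp only [innerₛₗ_apply_apply]; linarith
  have hval : ∀ x ∈ convexHull ℝ (ω '' (({a, b} : Finset (Fin n)) : Set (Fin n))),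
      ⟪z, x⟫ = ⟪z, ω a⟫ := by
    intro x hx
    refine convexHull_min (t := {x | innerₛₗ ℝ z x = ⟪z, ω a⟫}) ?_ ?_ hx
    · rintro _ ⟨k, hk, rfl⟩
      exact hab k hk
    · exact convex_hyperplane (innerₛₗ ℝ z).isLinear _
  have hsub : convexHull ℝ (ω '' (({a, b} : Finset (Fin n)) : Set (Fin n))) ⊆
      convexHull ℝ (range ω) := convexHull_mono (image_subset_range _ _)
  have hmemA : ω a ∈ convexHull ℝ (ω '' (({a, b} : Finset (Fin n)) : Set (Fin n))) :=
    subset_convexHull ℝ _ ⟨a, by simp, rfl⟩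
  refine ⟨⟨fun _ => ⟨innerSL ℝ z, ?_⟩, ?_, ?_⟩, ⟨ω a, hmemA, trivial⟩⟩
  · ext x
    simp only [Set.mem_ofPred_eq, innerSL_apply_apply]
    constructor
    · refine fun hx => ⟨hsub hx, fun y hy => ?_⟩
      rw [hval x hx]
      rcases lt_or_mem_convexHull_image hab hlt hy with h | h
      · exact h.le
      · exact h.1.le
    · rintro ⟨hx, hmax⟩
      rcases lt_or_mem_convexHull_image hab hlt hx with h | h
      · exact absurd (hmax _ (hsub hmemA)) (not_le.2 h)
      · exact h.2
  · intro heq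
    have hmem : ω j₀ ∈ convexHull ℝ (range ω) := subset_convexHull ℝ _ (mem_range_self _)
    rw [← heq] at hmem
    exact (hlt j₀ (by simpa using hj₀)).ne (hval _ hmem)
  · rw [image_pair_eq, finrank_vectorSpan_convexHull_pair hne]

lemma le_inner_sub_iSup_of_mem_sideEvent {n : ℕ} {s c : ℝ} (hs : s ^ 2 = 1) (hc : 0 < c)
    {a b j₀ : Fin n} (hj₀ : j₀ ∉ ({a, b} : Finset (Fin n))) {ω : Fin n → Euc 2}
    (hω : ω ∈ sideEvent s c a b {a, b}) {y : Euc 2}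
    (hy : IsOuterNormal (⊤ : Submodule ℝ (Euc 2)) (convexHull ℝ (range ω))
      (convexHull ℝ (ω '' (({a, b} : Finset (Fin n)) : Set (Fin n)))) y) :
    c ≤ ⟪y, ω a⟫ - ⨆ j : {j : Fin n // j ∉ ({a, b} : Finset (Fin n))}, ⟪y, ω j.1⟫ := by
  obtain ⟨hne, hside⟩ := hω
  obtain ⟨-, hnorm, hmax⟩ := hy
  have hrange : ∀ k, ω k ∈ convexHull ℝ (range ω) := fun k =>
    subset_convexHull ℝ _ (mem_range_self k)
  have hface : ∀ k ∈ ({a, b} : Finset (Fin n)),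
      ω k ∈ convexHull ℝ (ω '' (({a, b} : Finset (Fin n)) : Set (Fin n))) := fun k hk =>
    subset_convexHull ℝ _ ⟨k, hk, rfl⟩
  have hleA : ∀ k, ⟪y, ω k⟫ ≤ ⟪y, ω a⟫ := fun k =>
    hmax _ (hface a (by simp)) _ (hrange k)
  have horth : ⟪y, ω b - ω a⟫ = 0 := by
    rw [inner_sub_right]
    linarith [hleA b, hmax _ (hface b (by simp)) _ (hrange a)]
  obtain ⟨r, hr⟩ := exists_eq_smul_perp hne horth
  have hw : 0 < ‖ω b - ω a‖ := norm_pos_iff.2 hne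
  have hrw : |r| * ‖ω b - ω a‖ = 1 := by
    rw [← hnorm, hr, norm_smul, norm_perp (by norm_num), Real.norm_eq_abs]
  have hyx : ∀ x, ⟪y, x⟫ = r * s * ⟪perp s (ω b - ω a), x⟫ := by
    intro x
    rw [hr, inner_smul_left, inner_perp, inner_perp]
    simp only [conj_trivial]
    linear_combination (-r * ((ω b - ω a) 0 * x 1 - (ω b - ω a) 1 * x 0)) * hs
  have hsabs : |s| = 1 :=
    (pow_eq_one_iff_of_nonneg (abs_nonneg s) two_ne_zero).1 (by rwa [sq_abs])
  have hrs : r * s = |r| := by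
    have h1 := hleA j₀
    have h2 := hyx (ω j₀ - ω a)
    rw [inner_sub_right] at h2
    have h3 := hside j₀ hj₀
    have h4 : 0 < c * ‖ω b - ω a‖ := mul_pos hc hw
    have h5 : 0 ≤ r * s := by
      by_contra! h
      nlinarith
    rw [← abs_of_nonneg h5, abs_mul, hsabs, mul_one]
  have : Nonempty {j : Fin n // j ∉ ({a, b} : Finset (Fin n))} := ⟨⟨j₀, hj₀⟩⟩
  rw [le_sub_comm]
  refine ciSup_le fun j => ?_
  have h := hyx (ω j.1 - ω a)
  rw [inner_sub_right, hrs] at h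
  have h3 := mul_le_mul_of_nonneg_left (hside j.1 j.2) (abs_nonneg r)
  have h4 : |r| * -(c * ‖ω b - ω a‖) = -c := by linear_combination (-c) * hrw
  linarith

lemma edgeEvent_subset_sideEvent_union {n : ℕ} {a b : Fin n} :
    edgeEvent (⊤ : Submodule ℝ (Euc 2)) {a, b} ⊆
      sideEvent 1 0 a b {a, b} ∪ sideEvent (-1) 0 a b {a, b} := by
  rintro ω ⟨⟨hexp, hproper, hrank⟩, hnon⟩
  obtain ⟨l, hl⟩ := hexp hnon.left
  have hne : ω b - ω a ≠ 0 := by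
    intro h
    rw [image_pair_eq, sub_eq_zero.1 h, Set.pair_eq_singleton, convexHull_singleton,
      vectorSpan_singleton] at hrank
    simp at hrank
  have hrange : ∀ k, ω k ∈ convexHull ℝ (range ω) := fun k =>
    subset_convexHull ℝ _ (mem_range_self k)
  have hface : ∀ k ∈ ({a, b} : Finset (Fin n)), ∀ y ∈ convexHull ℝ (range ω), l y ≤ l (ω k) := by
    intro k hk
    have h : ω k ∈ convexHull ℝ (ω '' (({a, b} : Finset (Fin n)) : Set (Fin n))) :=
      subset_convexHull ℝ _ ⟨k, hk, rfl⟩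
    rw [hl] at h
    exact h.2
  set z := (InnerProductSpace.toDual ℝ (Euc 2)).symm l with hz
  have hlz : ∀ x, l x = ⟪z, x⟫ := fun x => by simp [hz]
  have horth : ⟪z, ω b - ω a⟫ = 0 := by
    rw [← hlz, map_sub]
    linarith [hface a (by simp) _ (hrange b), hface b (by simp) _ (hrange a)]
  obtain ⟨r, hr⟩ := exists_eq_smul_perp hne horth
  have hr0 : r ≠ 0 := by
    rintro rfl
    apply hproper
    rw [hl]
    ext x
    simp [hlz, hr]
  have hle : ∀ j, r * ⟪perp 1 (ω b - ω a), ω j - ω a⟫ ≤ 0 := fun j => by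
    have h := hface a (by simp) _ (hrange j)
    have h' := hlz (ω j - ω a)
    rw [hr, inner_smul_left, map_sub] at h'
    simp only [conj_trivial] at h'
    linarith
  rcases lt_or_gt_of_ne hr0 with h | h
  · refine Or.inr ⟨hne, fun j _ => ?_⟩
    have := nonneg_of_mul_nonpos_right (hle j) h
    rw [inner_perp] at this ⊢
    linarith
  · refine Or.inl ⟨hne, fun j _ => ?_⟩
    have := nonpos_of_mul_nonpos_right (hle j) h
    linarith

lemma disjoint_sideEvent_neg {n : ℕ} {c : ℝ} (hc : 0 < c) {a b j₀ : Fin n}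
    {I : Finset (Fin n)} (hj₀ : j₀ ∉ I) :
    Disjoint (sideEvent 1 c a b I) (sideEvent (-1) c a b I) := by
  refine Set.disjoint_left.2 fun ω h₁ h₂ => ?_
  have h := h₁.2 j₀ hj₀
  have h' := h₂.2 j₀ hj₀
  have hpos : 0 < c * ‖ω b - ω a‖ := mul_pos hc (norm_pos_iff.2 h₁.1)
  rw [inner_perp] at h h'
  linarith

lemma edgeEvent_univ_eq_empty {n d : ℕ} {W : Submodule ℝ (Euc d)} :
    edgeEvent W (Finset.univ : Finset (Fin n)) = ∅ := by
  refine Set.eq_empty_of_forall_notMem fun ω hω => hω.1.2.1 ?_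
  simp

/-- two-dimensional edge-to-rest distance lemma.
Let `a_1,…,a_n ∈ ℝ²` be independent with `L`-log-Lipschitz densities.  For `I = {i,i'}` of
size two, conditionally on the edge event `E_I` (assumed to have positive probability, so
that the conditioning is meaningful), the outer unit normal `y` of the edge
`conv(a_i, a_{i'})` of `conv(a_1,…,a_n)` satisfies
`Pr[ yᵀa_i - max_{j ∉ I} yᵀa_j ≥ 1/L | E_I ] ≥ 0.1` for each `i ∈ I`. -/
theorem stmt_3 (n : ℕ) (L : ℝ) (hL : 0 < L)
    (f : Fin n → Euc 2 → ℝ) (hf : ∀ i, IsLogLipschitz L (f i))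
    (hnorm : ∀ i, ∫⁻ x, ENNReal.ofReal (f i x) = 1)
    (I : Finset (Fin n)) (hI : I.card = 2)
    (hpos : 0 < productDensityMeasure f (edgeEvent (⊤ : Submodule ℝ (Euc 2)) I))
    (i : Fin n) (hiI : i ∈ I) :
    (1/10 : ℝ≥0∞) ≤
      (productDensityMeasure f)[|edgeEvent (⊤ : Submodule ℝ (Euc 2)) I]
        {ω | ∀ y : Euc 2,
          IsOuterNormal (⊤ : Submodule ℝ (Euc 2)) (convexHull ℝ (Set.range ω))
            (convexHull ℝ (ω '' ↑I)) y →
          1 / L ≤ ⟪y, ω i⟫ - ⨆ j : {j : Fin n // j ∉ I}, ⟪y, ω j.1⟫} := by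
  obtain ⟨b, hab, rfl⟩ : ∃ b, i ≠ b ∧ I = {i, b} := by
    obtain ⟨p, q, hpq, rfl⟩ := Finset.card_eq_two.1 hI
    rcases (by simpa using hiI : i = p ∨ i = q) with rfl | rfl
    · exact ⟨q, hpq, rfl⟩
    · exact ⟨p, hpq.symm, Finset.pair_comm _ _⟩
  obtain ⟨j₀, hj₀⟩ : ∃ j₀, j₀ ∉ ({i, b} : Finset (Fin n)) := by
    by_contra! h
    rw [Finset.eq_univ_of_forall h, edgeEvent_univ_eq_empty] at hpos
    simp at hpos
  set μ := productDensityMeasure f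
  set E := edgeEvent (⊤ : Submodule ℝ (Euc 2)) ({i, b} : Finset (Fin n))
  have hc : 0 < 1 / L := by positivity
  set B : ℝ → Set (Fin n → Euc 2) := fun s => sideEvent s (1 / L) i b {i, b}
  have hbound : μ E ≤ ENNReal.ofReal (Real.exp 1 ^ 2) * μ (B 1 ∪ B (-1)) := by
    rw [measure_union (disjoint_sideEvent_neg hc hj₀) (measurableSet_sideEvent ..), mul_add]
    refine (measure_mono edgeEvent_subset_sideEvent_union).trans ((measure_union_le _ _).trans ?_)
    exact add_le_add (productDensityMeasure_sideEvent_le hL (by norm_num) hf hab)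
      (productDensityMeasure_sideEvent_le hL (by norm_num) hf hab)
  have hexp : ENNReal.ofReal (Real.exp 1 ^ 2) ≤ 10 := by
    refine ENNReal.ofReal_le_of_le_toReal ?_
    have := Real.exp_one_lt_d9
    have := Real.exp_pos 1
    simp only [ENNReal.toReal_ofNat]
    nlinarith
  rw [ProbabilityTheory.cond, Measure.smul_apply, smul_eq_mul]
  refine le_trans ?_ (mul_le_mul_right (Measure.le_restrict_apply _ _) _)
  refine le_trans ?_ (mul_le_mul_right (measure_mono (s := B 1 ∪ B (-1)) ?_) _)
  · rw [← ENNReal.div_eq_inv_mul, ENNReal.le_div_iff_mul_le (Or.inl hpos.ne')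
      (Or.inl (productDensityMeasure_ne_top hf hnorm _)), one_div, ← ENNReal.div_eq_inv_mul]
    refine ENNReal.div_le_of_le_mul' (hbound.trans ?_)
    gcongr
  · rintro ω (hω | hω)
    · exact ⟨fun y hy => le_inner_sub_iSup_of_mem_sideEvent (by norm_num) hc hj₀ hω hy,
        sideEvent_subset_edgeEvent hc hj₀ hω⟩
    · exact ⟨fun y hy => le_inner_sub_iSup_of_mem_sideEvent (by norm_num) hc hj₀ hω hy,
        sideEvent_subset_edgeEvent hc hj₀ hω⟩
end
end
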